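/- arXiv:1504.04422 — 2 statements merged into one kernel-verified Lean document; each statement's English description precedes it below -/
import Mathlib

section
/- Let Γ be a finite connected non-complete graph of prime valency p that is 2-geodesic transitive but not 2-arc transitive. Then for every vertex u of Γ, the subgraph of Γ induced on the neighbourhood Γ(u) is isomorphic to the Paley graph P(p). -/
open SimpleGraph

/-- `Γ` is arc transitive: its automorphism group is transitive on ordered pairs
of adjacent vertices. -/
def ArcTransitive {V : Type*} (Γ : SimpleGraph V) : Prop :=
  ∀ ⦃v u v' u' : V⦄, Γ.Adj v u → Γ.Adj v' u' →
    ∃ φ : Γ ≃g Γ, φ v = v' ∧ φ u = u'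

/-- `(v,u,w)` is a 2-arc of `Γ`. -/
def Is2Arc {V : Type*} (Γ : SimpleGraph V) (v u w : V) : Prop :=
  Γ.Adj v u ∧ Γ.Adj u w ∧ v ≠ w

/-- `(v,u,w)` is a 2-geodesic of `Γ`: a 2-arc with `v`, `w` non-adjacent. -/
def Is2Geodesic {V : Type*} (Γ : SimpleGraph V) (v u w : V) : Prop :=
  Γ.Adj v u ∧ Γ.Adj u w ∧ v ≠ w ∧ ¬ Γ.Adj v w

/-- `Γ` is 2-arc transitive: arc transitive and transitive on 2-arcs. -/
def TwoArcTransitive {V : Type*} (Γ : SimpleGraph V) : Prop :=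
  ArcTransitive Γ ∧
  ∀ ⦃v u w v' u' w' : V⦄, Is2Arc Γ v u w → Is2Arc Γ v' u' w' →
    ∃ φ : Γ ≃g Γ, φ v = v' ∧ φ u = u' ∧ φ w = w'

/-- `Γ` is 2-geodesic transitive: arc transitive and transitive on 2-geodesics. -/
def TwoGeodesicTransitive {V : Type*} (Γ : SimpleGraph V) : Prop :=
  ArcTransitive Γ ∧
  ∀ ⦃v u w v' u' w' : V⦄, Is2Geodesic Γ v u w → Is2Geodesic Γ v' u' w' →
    ∃ φ : Γ ≃g Γ, φ v = v' ∧ φ u = u' ∧ φ w = w'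

/-- The Paley graph on the field `F`: distinct `u`, `v` are adjacent iff `u - v` is
a nonzero square (symmetrised via `fromRel`; when `|F| ≡ 1 (mod 4)` the relation is
already symmetric, since `-1` is then a square). -/
def paleyGraph (F : Type*) [Field F] : SimpleGraph F :=
  SimpleGraph.fromRel (fun u v => ∃ x : F, x ≠ 0 ∧ u - v = x ^ 2)

open Polynomial in
/-- Summing the translates of a polynomial over a finite set, in terms of power sums. -/
theorem Polynomial.coeff_sum_taylor {R : Type*} [CommRing R] (U : Finset R) (P : R[X]) (j : ℕ) :
    (∑ u ∈ U, taylor u P).coeff j =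
      ∑ i ∈ P.support, (i.choose j : R) * P.coeff i * ∑ u ∈ U, u ^ (i - j) := by
  simp only [finsetSum_coeff, taylor_coeff, hasseDeriv_apply, Polynomial.sum, eval_finsetSum,
    eval_monomial, Finset.mul_sum]
  exact Finset.sum_comm

open Polynomial in
theorem Polynomial.sum_taylor_of_natDegree_lt {R : Type*} [CommRing R] (U : Finset R) (P : R[X])
    {r : ℕ} (hs : ∀ k, 0 < k → k < r → ∑ u ∈ U, u ^ k = 0) (hP : P.natDegree < r) :
    ∑ u ∈ U, taylor u P = (U.card : R[X]) * P := by
  ext j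
  rw [coeff_sum_taylor, ← C_eq_natCast, coeff_C_mul, Finset.sum_eq_single j]
  · simp [mul_comm]
  · intro i hi hij
    rcases lt_or_gt_of_ne hij with h | h
    · simp [Nat.choose_eq_zero_of_lt h]
    · rw [hs _ (by omega) (by have := le_natDegree_of_mem_supp i hi; omega), mul_zero]
  · intro h
    simp [notMem_support_iff.mp h]

open Polynomial in
theorem Polynomial.coeff_sum_taylor_natDegree_sub {R : Type*} [CommRing R] (U : Finset R)
    (P : R[X]) {r : ℕ} (hr : 0 < r) (hs : ∀ k, 0 < k → k < r → ∑ u ∈ U, u ^ k = 0)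
    (hP : r ≤ P.natDegree) :
    (∑ u ∈ U, taylor u P).coeff (P.natDegree - r) = U.card * P.coeff (P.natDegree - r) +
      (P.natDegree.choose r : R) * P.leadingCoeff * ∑ u ∈ U, u ^ r := by
  have hsub : P.support ⊆ Finset.range (P.natDegree + 1) := supp_subset_range_natDegree_succ
  rw [coeff_sum_taylor, Finset.sum_subset hsub
    (fun i _ hi => by simp [notMem_support_iff.mp hi]),
    ← Finset.add_sum_erase _ _ (Finset.mem_range.mpr
      (by omega : P.natDegree - r < P.natDegree + 1)),
    Finset.sum_eq_single P.natDegree]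
  · rw [Nat.choose_symm hP, Nat.sub_sub_self hP]
    simp [mul_comm]
  · intro i hi hij
    simp only [Finset.mem_erase, Finset.mem_range] at hi
    rcases lt_or_gt_of_ne hi.1 with h | h
    · simp [Nat.choose_eq_zero_of_lt h]
    · rw [hs _ (by omega) (by omega), mul_zero]
  · intro h
    exact absurd (Finset.mem_erase.mpr ⟨by omega, Finset.mem_range.mpr (by omega)⟩) h

open Polynomial in
theorem Finset.exists_sum_pow_ne_zero {F : Type*} [Field F] (U : Finset F) (hU : U.Nonempty)
    (h0 : (0 : F) ∉ U) : ∃ k, 0 < k ∧ k ≤ U.card ∧ ∑ u ∈ U, u ^ k ≠ 0 := by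
  classical
  by_contra! hs
  obtain ⟨a, ha⟩ := hU
  set g : F[X] := X * ∏ u ∈ U.erase a, (X - C u) with hg
  have hdeg : g.natDegree < U.card + 1 := by
    have h1 : g.natDegree ≤ _ := natDegree_mul_le
    have h2 : (∏ u ∈ U.erase a, (X - C u)).natDegree = (U.erase a).card := by
      simp
    rw [h2, Finset.card_erase_of_mem ha] at h1
    have := Finset.card_pos.mpr ⟨a, ha⟩
    have := natDegree_X_le (R := F)
    omega
  have hzero : ∑ u ∈ U, g.eval u = 0 := by
    simp only [eval_eq_sum_range' hdeg]
    rw [Finset.sum_comm]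
    refine Finset.sum_eq_zero fun k hk => ?_
    rw [← Finset.mul_sum]
    rcases Nat.eq_zero_or_pos k with rfl | hk0
    · simp [hg]
    · rw [hs k hk0 (Nat.lt_succ_iff.mp (Finset.mem_range.mp hk)), mul_zero]
  rw [Finset.sum_eq_single a, hg, eval_mul, eval_X, eval_prod] at hzero
  · rcases mul_eq_zero.mp hzero with h | h
    · exact h0 (h ▸ ha)
    · obtain ⟨u, hu, hu0⟩ := Finset.prod_eq_zero_iff.mp h
      simp only [eval_sub, eval_X, eval_C] at hu0
      exact (Finset.mem_erase.mp hu).1 (sub_eq_zero.mp hu0).symm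
  · intro u hu hua
    rw [hg, eval_mul, eval_prod, Finset.prod_eq_zero (Finset.mem_erase.mpr ⟨hua, hu⟩) (by simp),
      mul_zero]
  · exact fun h => absurd ha h

open Polynomial in
theorem ZMod.exists_affine_of_two_mul_card_lt {p : ℕ} [Fact p.Prime] (U : Finset (ZMod p))
    (hU : U.Nonempty) (h0 : (0 : ZMod p) ∉ U) (hcard : 2 * U.card < p)
    (f : ZMod p → ZMod p) (hinj : Function.Injective f)
    (hf : ∀ x, ∀ u ∈ U, f (x + u) - f x ∈ U) : ∃ a b, ∀ x, f x = a * x + b := by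
  classical
  have hp : p.Prime := Fact.out
  obtain ⟨Q, hQdeg, hQ⟩ : ∃ Q : (ZMod p)[X], Q.natDegree < p ∧ ∀ x, Q.eval x = f x := by
    refine ⟨Lagrange.interpolate Finset.univ id f, ?_, fun x =>
      Lagrange.eval_interpolate_at_node f Function.injective_id.injOn (Finset.mem_univ x)⟩
    have h := Lagrange.degree_interpolate_lt (s := Finset.univ) (v := id) f
      Function.injective_id.injOn
    rw [Finset.card_univ, ZMod.card] at h
    by_cases hz : Lagrange.interpolate Finset.univ id f = 0
    · rw [hz, natDegree_zero]
      exact hp.pos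
    · exact (natDegree_lt_iff_degree_lt hz).mpr h
  have hshift : ∀ (h : ZMod p → ZMod p) (x), ∑ u ∈ U, h (f (x + u)) = ∑ u ∈ U, h (f x + u) := by
    intro h x
    have himg : U.image (fun u => f (x + u) - f x) = U := by
      refine Finset.eq_of_subset_of_card_le (fun y hy => ?_) ?_
      · obtain ⟨u, hu, rfl⟩ := Finset.mem_image.mp hy
        exact hf x u hu
      · rw [Finset.card_image_of_injective]
        exact fun a b hab => add_left_cancel (hinj (sub_left_injective hab))
    conv_rhs => rw [← himg, Finset.sum_image fun a _ b _ hab =>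
      add_left_cancel (hinj (sub_left_injective hab))]
    simp
  have hext : ∀ P R : (ZMod p)[X], P.natDegree < p → R.natDegree < p →
      (∀ x, P.eval x = R.eval x) → P = R := by
    intro P R hP hR h
    refine sub_eq_zero.mp (eq_zero_of_natDegree_lt_card_of_eval_eq_zero' _ Finset.univ
      (fun x _ => by simp [h x]) ?_)
    rw [Finset.card_univ, ZMod.card]
    exact (natDegree_sub_le _ _).trans_lt (max_lt hP hR)
  have hsumdeg : ∀ P : (ZMod p)[X], P.natDegree < p → (∑ u ∈ U, taylor u P).natDegree < p := by
    intro P hP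
    refine (natDegree_sum_le_of_forall_le (n := P.natDegree) U _ fun u _ => ?_).trans_lt hP
    rw [natDegree_taylor]
  have hex := Finset.exists_sum_pow_ne_zero U hU h0
  obtain ⟨hr0, hrU, hrs⟩ := Nat.find_spec hex
  set r := Nat.find hex with hr
  have hs : ∀ k, 0 < k → k < r → ∑ u ∈ U, u ^ k = 0 := by
    intro k hk hkr
    by_contra hne
    exact Nat.find_min hex hkr ⟨hk, hkr.le.trans hrU, hne⟩
  have hlead : ∀ P : (ZMod p)[X], P.natDegree < p → r ≤ P.natDegree →
      (∑ u ∈ U, taylor u P).coeff (P.natDegree - r) ≠ U.card * P.coeff (P.natDegree - r) := by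
    intro P hP hrP h
    rw [coeff_sum_taylor_natDegree_sub U P hr0 hs hrP, add_eq_left] at h
    have hc : ((P.natDegree.choose r : ℕ) : ZMod p) ≠ 0 := by
      rw [Ne, ZMod.natCast_eq_zero_iff]
      intro hd
      have h2 : p ∣ P.natDegree.factorial := by
        rw [← Nat.choose_mul_factorial_mul_factorial hrP, mul_assoc]
        exact hd.mul_right _
      exact absurd (hp.dvd_factorial.mp h2) (not_le.mpr hP)
    have hl : P.leadingCoeff ≠ 0 := by
      rw [Ne, leadingCoeff_eq_zero]
      rintro rfl
      simp at hrP
      omega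
    exact mul_ne_zero (mul_ne_zero hc hl) hrs h
  suffices hd : Q.natDegree ≤ 1 by
    refine ⟨Q.coeff 1, Q.coeff 0, fun x => ?_⟩
    rw [← hQ x, eval_eq_sum_range' (Nat.lt_succ_of_le hd)]
    simp [Finset.sum_range_succ]
    ring
  by_cases hr1 : r = 1
  · by_contra! hd
    have heq : ∑ u ∈ U, taylor u Q = C (U.card : ZMod p) * Q + C (∑ u ∈ U, u) := by
      refine hext _ _ (hsumdeg Q hQdeg) ?_ fun x => ?_
      · exact (natDegree_add_C.trans_le (natDegree_C_mul_le _ _)).trans_lt hQdeg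
      · have := hshift id x
        simp only [id] at this
        simp only [eval_finsetSum, taylor_eval, hQ, eval_add, eval_mul, eval_C]
        rw [this, Finset.sum_add_distrib, Finset.sum_const, nsmul_eq_mul]
    apply hlead Q hQdeg (by omega)
    rw [heq, coeff_add, coeff_C_mul, coeff_C, if_neg (by omega), add_zero]
  · have hpow : ∀ j, j < r → j * Q.natDegree < p → j * Q.natDegree < r := by
      intro j hj hjp
      rw [← natDegree_pow] at hjp ⊢
      by_contra! hle
      refine hlead (Q ^ j) hjp hle ?_
      have heq : ∑ u ∈ U, taylor u (Q ^ j) = C (U.card : ZMod p) * Q ^ j := by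
        refine hext _ _ (hsumdeg _ hjp) ((natDegree_C_mul_le _ _).trans_lt hjp) fun x => ?_
        have h1 := hshift (fun y => y ^ j) x
        have h2 := congrArg (eval (f x)) (sum_taylor_of_natDegree_lt U (X ^ j) hs (by simpa))
        simp only [eval_finsetSum, taylor_eval, eval_pow, eval_X, eval_mul,
          eval_natCast] at h2
        simp only [eval_finsetSum, taylor_eval, eval_pow, eval_mul, hQ, eval_C,
          h1, ← h2]
      rw [heq, coeff_C_mul]
    have hind : ∀ j, j < r → j * Q.natDegree < r := by
      intro j
      induction j with
      | zero => intro _; omega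
      | succ j ih =>
        intro hj
        refine hpow _ hj ?_
        rcases Nat.eq_zero_or_pos j with rfl | hj0
        · simpa using hQdeg
        · have := ih (by omega)
          have : Q.natDegree ≤ j * Q.natDegree := Nat.le_mul_of_pos_left _ hj0
          rw [add_mul, one_mul]
          omega
    by_contra! hd
    have h1 := hind (r - 1) (by omega)
    have h2 : (r - 1) * 2 ≤ (r - 1) * Q.natDegree := Nat.mul_le_mul_left _ hd
    omega

/-- A permutation of `ZMod p` preserving a nontrivial translation-invariant relation is affine. -/
theorem ZMod.exists_affine_of_sub_mem_iff {p : ℕ} [Fact p.Prime] (U : Set (ZMod p))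
    (hU : U.Nonempty) (h0 : (0 : ZMod p) ∉ U) (hU' : ∃ x, x ≠ 0 ∧ x ∉ U)
    (f : ZMod p → ZMod p) (hinj : Function.Injective f)
    (hf : ∀ x y, f y - f x ∈ U ↔ y - x ∈ U) : ∃ a b, ∀ x, f x = a * x + b := by
  classical
  set A : Finset (ZMod p) := {x | x ∈ U}
  set B : Finset (ZMod p) := {x | x ≠ 0 ∧ x ∉ U}
  have hAB : A.card + B.card < p := by
    rw [← Finset.card_union_of_disjoint]
    · conv_rhs => rw [← ZMod.card p, ← Finset.card_univ]
      refine Finset.card_lt_card (Finset.ssubset_univ_iff.mpr fun h => ?_)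
      have := h ▸ Finset.mem_univ (0 : ZMod p)
      simp [A, B, h0] at this
    · rw [Finset.disjoint_left]
      intro x hx hx'
      simp [A, B] at hx hx'
      exact hx'.2 hx
  by_cases h : 2 * A.card < p
  · refine ZMod.exists_affine_of_two_mul_card_lt A ?_ (by simpa [A]) h f hinj fun x u hu => ?_
    · obtain ⟨x, hx⟩ := hU
      exact ⟨x, by simpa [A]⟩
    · simpa [A, hf] using hu
  · refine ZMod.exists_affine_of_two_mul_card_lt B ?_ (by simp [B]) (by omega) f hinj
      fun x u hu => ?_
    · obtain ⟨x, hx⟩ := hU'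
      exact ⟨x, by simpa [B]⟩
    · simpa [B, hf, sub_eq_zero, hinj.eq_iff] using hu

/-- A transitive group of prime degree `p` contains a `p`-cycle; here the points are labelled so
that it becomes translation by one. -/
theorem Subgroup.exists_equiv_zmod_of_transitive {α : Type*} [Finite α] {p : ℕ} [Fact p.Prime]
    (hcard : Nat.card α = p) (G : Subgroup (Equiv.Perm α)) (hG : ∀ a b, ∃ g ∈ G, g a = b) :
    ∃ e : ZMod p ≃ α, ∃ σ ∈ G, ∀ x, σ (e x) = e (x + 1) := by
  classical
  have hp : p.Prime := Fact.out
  have := Fintype.ofFinite α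
  have hcard' : Fintype.card α = p := by rw [← hcard, Nat.card_eq_fintype_card]
  obtain ⟨a⟩ : Nonempty α := Fintype.card_pos_iff.mp (hcard' ▸ hp.pos)
  have : MulAction.IsPretransitive G α :=
    ⟨fun x y => let ⟨g, hg, h⟩ := hG x y; ⟨⟨g, hg⟩, h⟩⟩
  have hdvd : p ∣ Nat.card G := by
    rw [← hcard, ← MulAction.index_stabilizer_of_transitive G a]
    exact Subgroup.index_dvd_card _
  obtain ⟨⟨σ, hσ⟩, hord⟩ := exists_prime_orderOf_dvd_card' p hdvd
  rw [Subgroup.orderOf_mk] at hord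
  have hcyc : σ.IsCycle := Equiv.Perm.isCycle_of_prime_order'' (hcard'.symm ▸ hp)
    (hord.trans hcard'.symm)
  have hsupp : σ.support = Finset.univ := by
    rw [← Finset.card_eq_iff_eq_univ, ← hcyc.orderOf, hord, hcard']
  have hmove : ∀ x, σ x ≠ x := fun x => Equiv.Perm.mem_support.mp (hsupp ▸ Finset.mem_univ x)
  have hmod : ∀ m n : ℕ, (m : ZMod p) = n → σ ^ m = σ ^ n := by
    intro m n h
    rw [pow_eq_pow_iff_modEq, hord]
    exact (ZMod.natCast_eq_natCast_iff _ _ _).mp h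
  have hsurj : Function.Surjective fun x : ZMod p => (σ ^ x.val) a := by
    intro b
    obtain ⟨i, rfl⟩ := hcyc.exists_pow_eq (hmove a) (hmove b)
    exact ⟨i, congrArg (· a) (hmod _ _ (by simp))⟩
  have hbij := (Fintype.bijective_iff_surjective_and_card _).mpr
    ⟨hsurj, (ZMod.card p).trans hcard'.symm⟩
  refine ⟨Equiv.ofBijective _ hbij, σ, hσ, fun x => ?_⟩
  simp only [Equiv.ofBijective_apply]
  rw [hmod (x + 1).val (x.val + 1) (by simp), pow_succ', Equiv.Perm.mul_apply]

theorem ArcTransitive.exists_local_coordinates {V : Type*} [Finite V] {Γ : SimpleGraph V} {p : ℕ}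
    [Fact p.Prime] (h : ArcTransitive Γ) {u : V} (hcard : Nat.card (Γ.neighborSet u) = p) :
    ∃ e : ZMod p ≃ Γ.neighborSet u,
      ∀ x y z, Γ.Adj (e (x + z)) (e (y + z)) ↔ Γ.Adj (e x) (e y) := by
  let G : Subgroup (Equiv.Perm (Γ.neighborSet u)) :=
    { carrier := {σ | ∃ φ : Γ ≃g Γ, ∀ x, (σ x : V) = φ x}
      one_mem' := ⟨RelIso.refl _, fun _ => rfl⟩
      mul_mem' := by
        rintro σ τ ⟨φ, hφ⟩ ⟨ψ, hψ⟩
        exact ⟨ψ.trans φ, fun x => by simp [hφ, hψ]⟩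
      inv_mem' := by
        rintro σ ⟨φ, hφ⟩
        refine ⟨φ.symm, fun x => ?_⟩
        rw [eq_comm, RelIso.symm_apply_eq, ← hφ]
        simp }
  obtain ⟨e, σ, ⟨φ, hφ⟩, he⟩ := G.exists_equiv_zmod_of_transitive hcard fun a b => by
    obtain ⟨φ, hu, hab⟩ := h a.2 b.2
    have hmem : ∀ x, Γ.Adj u x ↔ Γ.Adj u (φ x) := fun x => by
      rw [← φ.map_adj_iff, hu]
    exact ⟨φ.toEquiv.subtypeEquiv hmem, ⟨φ, fun _ => rfl⟩, Subtype.ext hab⟩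
  refine ⟨e, fun x y z => ?_⟩
  obtain ⟨n, rfl⟩ := ZMod.natCast_zmod_surjective z
  induction n with
  | zero => simp
  | succ n ih =>
    refine Iff.trans ?_ ih
    rw [Nat.cast_succ, ← add_assoc, ← add_assoc, ← he, ← he, hφ, hφ, φ.map_adj_iff]

theorem exists_affine_of_local_coordinates {V : Type*} {Γ : SimpleGraph V} {p : ℕ}
    [Fact p.Prime] {u : V} (e : ZMod p ≃ Γ.neighborSet u)
    (he : ∀ x y z, Γ.Adj (e (x + z)) (e (y + z)) ↔ Γ.Adj (e x) (e y))
    (hadj : ∃ x, Γ.Adj (e 0) (e x)) (hnadj : ∃ x, x ≠ 0 ∧ ¬ Γ.Adj (e 0) (e x))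
    (φ : Γ ≃g Γ) (hφ : φ u = u) : ∃ a b, ∀ x, φ (e x) = e (a * x + b) := by
  have hmem : ∀ x, Γ.Adj u (φ (e x)) := fun x => by
    have := φ.map_adj_iff.mpr (e x).2
    rwa [hφ] at this
  let f : ZMod p → ZMod p := fun x => e.symm ⟨φ (e x), hmem x⟩
  have hf : ∀ x, φ (e x) = e (f x) := fun x => by simp [f]
  have hsub : ∀ x y, Γ.Adj (e 0) (e (y - x)) ↔ Γ.Adj (e x) (e y) := fun x y => by
    rw [← he 0 (y - x) x, zero_add, sub_add_cancel]
  obtain ⟨a, b, hab⟩ := ZMod.exists_affine_of_sub_mem_iff {x | Γ.Adj (e 0) (e x)} hadj (by simp)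
    hnadj f (fun x y hxy => by
      have := congrArg (fun z => (e z : V)) hxy
      simp only [← hf] at this
      exact e.injective (Subtype.ext (φ.injective this)))
    (fun x y => by
      simp only [Set.mem_ofPred_eq, hsub]
      rw [← hf, ← hf, φ.map_adj_iff])
  exact ⟨a, b, fun x => by rw [hf, hab]⟩

theorem exists_subgroup_of_local_coordinates {V : Type*} {Γ : SimpleGraph V} {p : ℕ}
    [Fact p.Prime] {u : V} (h : TwoGeodesicTransitive Γ) (e : ZMod p ≃ Γ.neighborSet u)
    (he : ∀ x y z, Γ.Adj (e (x + z)) (e (y + z)) ↔ Γ.Adj (e x) (e y))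
    (hadj : ∃ x, Γ.Adj (e 0) (e x)) (hnadj : ∃ x, x ≠ 0 ∧ ¬ Γ.Adj (e 0) (e x)) :
    ∃ H : Subgroup (ZMod p)ˣ,
      (∀ a ∈ H, ∀ x, Γ.Adj (e 0) (e (a * x)) ↔ Γ.Adj (e 0) (e x)) ∧
      ∀ x y, x ≠ 0 → ¬ Γ.Adj (e 0) (e x) → y ≠ 0 → ¬ Γ.Adj (e 0) (e y) →
        ∃ a ∈ H, a * x = y := by
  refine ⟨{ carrier := {a | ∀ x, Γ.Adj (e 0) (e (a * x)) ↔ Γ.Adj (e 0) (e x)}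
            one_mem' := by simp
            mul_mem' := fun {a b} ha hb x => by rw [Units.val_mul, mul_assoc, ha, hb]
            inv_mem' := fun {a} ha x => by rw [← ha, Units.mul_inv_cancel_left] },
    fun a ha => ha, fun x y hx hx' hy hy' => ?_⟩
  have hgeo : ∀ x, x ≠ 0 → ¬ Γ.Adj (e 0) (e x) → Is2Geodesic Γ (e 0) u (e x) := fun x hx hx' =>
    ⟨(e 0).2.symm, (e x).2, fun h => hx (e.injective (Subtype.ext h)).symm, hx'⟩
  obtain ⟨φ, h0, hu, hxy⟩ := h.2 (hgeo x hx hx') (hgeo y hy hy')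
  obtain ⟨a, b, hab⟩ := exists_affine_of_local_coordinates e he hadj hnadj φ hu
  have hb : b = 0 := by
    have := hab 0
    rw [h0, mul_zero, zero_add] at this
    exact (e.injective (Subtype.ext this)).symm
  subst hb
  simp only [add_zero] at hab
  have hax : a * x = y := by
    rw [hab] at hxy
    exact e.injective (Subtype.ext hxy)
  have ha : a ≠ 0 := by
    rintro rfl
    exact hy (by rw [← hax, zero_mul])
  refine ⟨Units.mk0 a ha, fun z => ?_, hax⟩
  rw [Units.val_mk0, ← hab]
  nth_rw 1 [← h0]
  exact φ.map_adj_iff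

theorem SimpleGraph.Iso.card_neighborFinset_inter {V : Type*} [Fintype V] [DecidableEq V]
    {Γ : SimpleGraph V} [DecidableRel Γ.Adj] (φ : Γ ≃g Γ) (v w : V) :
    (Γ.neighborFinset (φ v) ∩ Γ.neighborFinset (φ w)).card =
      (Γ.neighborFinset v ∩ Γ.neighborFinset w).card := by
  symm
  refine Finset.card_bij (fun x _ => φ x) (fun x hx => ?_) (fun _ _ _ _ h => φ.injective h)
    fun y hy => ⟨φ.symm y, ?_, φ.apply_symm_apply y⟩
  · simpa [φ.map_adj_iff] using hx
  · obtain ⟨x, rfl⟩ := φ.surjective y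
    simpa [φ.map_adj_iff] using hy

/-- Inclusion-exclusion among the neighbours of the middle vertex of a 2-geodesic. -/
theorem Is2Geodesic.le_card_neighborFinset_inter {V : Type*} [Fintype V] [DecidableEq V]
    {Γ : SimpleGraph V} [DecidableRel Γ.Adj] {v u w : V} (h : Is2Geodesic Γ v u w) :
    (Γ.neighborFinset u ∩ Γ.neighborFinset v).card +
      (Γ.neighborFinset u ∩ Γ.neighborFinset w).card + 3 ≤
      (Γ.neighborFinset u).card + (Γ.neighborFinset v ∩ Γ.neighborFinset w).card := by
  obtain ⟨hvu, huw, hne, hnadj⟩ := h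
  set A := Γ.neighborFinset u ∩ Γ.neighborFinset v
  set B := Γ.neighborFinset u ∩ Γ.neighborFinset w
  have h1 : (A ∪ B).card + 2 ≤ (Γ.neighborFinset u).card := by
    rw [← Finset.card_pair hne, ← Finset.card_union_of_disjoint]
    · refine Finset.card_le_card fun x hx => ?_
      simp only [Finset.mem_union, Finset.mem_insert, Finset.mem_singleton, A, B,
        Finset.mem_inter, mem_neighborFinset] at hx ⊢
      rcases hx with (hx | hx) | rfl | rfl
      exacts [hx.1, hx.1, hvu.symm, huw]
    · rw [Finset.disjoint_left]
      intro x hx hx'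
      simp only [Finset.mem_union, Finset.mem_insert, Finset.mem_singleton, A, B,
        Finset.mem_inter, mem_neighborFinset] at hx hx'
      have hnadj' := fun h => hnadj (Γ.adj_symm h)
      rcases hx' with rfl | rfl <;> simp_all
  have h2 : (A ∩ B).card + 1 ≤ (Γ.neighborFinset v ∩ Γ.neighborFinset w).card := by
    rw [← Finset.card_insert_of_notMem (a := u) (by simp [A])]
    refine Finset.card_le_card fun x hx => ?_
    simp only [Finset.mem_insert, A, B, Finset.mem_inter, mem_neighborFinset] at hx ⊢
    rcases hx with rfl | hx
    exacts [⟨hvu, huw.symm⟩, ⟨hx.1.2, hx.2.2⟩]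
  have := Finset.card_union_add_card_inter A B
  omega

/-- Double counting the edges between the first and second neighbourhoods of `u`. -/
theorem card_mul_eq_of_is2Geodesic {V : Type*} [Fintype V] [DecidableEq V]
    {Γ : SimpleGraph V} [DecidableRel Γ.Adj] {p k m c : ℕ} (hkm : k + m + 1 = p)
    (hreg : ∀ v, (Γ.neighborFinset v).card = p)
    (hk : ∀ v w, Γ.Adj v w → (Γ.neighborFinset v ∩ Γ.neighborFinset w).card = k)
    (hc : ∀ v u w, Is2Geodesic Γ v u w → (Γ.neighborFinset v ∩ Γ.neighborFinset w).card = c)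
    (u : V) : ∃ t, p * m = t * c := by
  classical
  let T : Finset V := {w | ∃ v, Is2Geodesic Γ u v w}
  refine ⟨T.card, ?_⟩
  rw [← hreg u]
  refine Finset.card_mul_eq_card_mul Γ.Adj (fun v hv => ?_) fun w hw => ?_
  · rw [mem_neighborFinset] at hv
    have h1 : T.bipartiteAbove Γ.Adj v =
        (Γ.neighborFinset v \ (Γ.neighborFinset u ∩ Γ.neighborFinset v)).erase u := by
      ext w
      simp only [Finset.mem_bipartiteAbove, T, Finset.mem_filter, Finset.mem_univ, true_and,
        Finset.mem_erase, Finset.mem_sdiff, Finset.mem_inter, mem_neighborFinset]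
      exact ⟨fun ⟨⟨_, _, _, h1, h2⟩, h3⟩ => ⟨h1.symm, h3, fun h => h2 h.1⟩,
        fun ⟨h1, h2, h3⟩ => ⟨⟨v, hv, h2, h1.symm, fun h => h3 ⟨h, h2⟩⟩, h2⟩⟩
    rw [h1, Finset.card_erase_of_mem (by simp [hv.symm]),
      Finset.card_sdiff_of_subset Finset.inter_subset_right, hreg, hk u v hv]
    omega
  · simp only [T, Finset.mem_filter, Finset.mem_univ, true_and] at hw
    obtain ⟨v, hv⟩ := hw
    rw [← hc u v w hv]
    congr 1
    ext x
    simp [Finset.mem_bipartiteBelow, Γ.adj_comm x w]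

theorem ZMod.mem_subgroup_iff_isSquare {p : ℕ} [Fact p.Prime] (H : Subgroup (ZMod p)ˣ)
    (hH : 2 * Nat.card H + 1 = p) (a : (ZMod p)ˣ) :
    a ∈ H ↔ ∃ x : ZMod p, x ≠ 0 ∧ (a : ZMod p) = x ^ 2 := by
  have hindex : H.index = 2 := by
    have h1 := H.card_mul_index
    rw [Nat.card_eq_fintype_card (α := (ZMod p)ˣ), ZMod.card_units p] at h1
    have h2 : 0 < Nat.card H := Nat.card_pos
    refine Nat.eq_of_mul_eq_mul_left h2 ?_
    omega
  have hp2 : p ≠ 2 := by omega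
  have hp : p.Prime := Fact.out
  have hpow : a ∈ H → a ^ (p / 2) = 1 := fun ha => by
    have h3 : p / 2 = Nat.card H := by omega
    rw [h3]
    exact congrArg Subtype.val (pow_card_eq_one' (x := (⟨a, ha⟩ : H)))
  constructor
  · intro ha
    obtain ⟨y, hy⟩ := (ZMod.euler_criterion_units p a).mpr (hpow ha)
    exact ⟨y, y.ne_zero, by rw [← hy]; simp⟩
  · rintro ⟨x, hx, hax⟩
    have : a = Units.mk0 x hx ^ 2 := Units.ext (by simp [hax])
    rw [this]
    exact H.sq_mem_of_index_two hindex _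

theorem exists_iso_paleyGraph {V : Type*} {Γ : SimpleGraph V} {p : ℕ} [Fact p.Prime] {u : V}
    (e : ZMod p ≃ Γ.neighborSet u)
    (he : ∀ x y z, Γ.Adj (e (x + z)) (e (y + z)) ↔ Γ.Adj (e x) (e y))
    (H : Subgroup (ZMod p)ˣ) (hH : 2 * Nat.card H + 1 = p)
    (hmul : ∀ a ∈ H, ∀ x, Γ.Adj (e 0) (e (a * x)) ↔ Γ.Adj (e 0) (e x))
    (hcard : Nat.card {x // Γ.Adj (e 0) (e x)} = Nat.card H) :
    Nonempty ((SimpleGraph.induce (Γ.neighborSet u) Γ) ≃g paleyGraph (ZMod p)) := by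
  have hpos : 0 < Nat.card {x // Γ.Adj (e 0) (e x)} := hcard ▸ Nat.card_pos
  obtain ⟨⟨s, hs⟩⟩ := (Nat.card_pos_iff.mp hpos).1
  have hs0 : s ≠ 0 := by
    rintro rfl
    exact Γ.irrefl hs
  let g : H → {x // Γ.Adj (e 0) (e x)} := fun a => ⟨a.1 * s, (hmul _ a.2 s).mpr hs⟩
  have hg : Function.Bijective g := by
    refine (Nat.bijective_iff_injective_and_card g).mpr ⟨fun a b hab => ?_, hcard.symm⟩
    exact Subtype.ext (Units.ext (mul_right_cancel₀ hs0 (congrArg Subtype.val hab)))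
  have key : ∀ x y, Γ.Adj (e x) (e y) ↔ ∃ z : ZMod p, z ≠ 0 ∧ y / s - x / s = z ^ 2 := by
    intro x y
    rw [← sub_add_cancel y x]
    nth_rw 1 [← zero_add x]
    rw [he, ← sub_div, sub_add_cancel]
    constructor
    · intro h
      obtain ⟨a, ha⟩ := hg.2 ⟨_, h⟩
      obtain ⟨z, hz, hz'⟩ := (ZMod.mem_subgroup_iff_isSquare H hH a).mp a.2
      exact ⟨z, hz, by rw [← hz', div_eq_iff hs0]; exact (congrArg Subtype.val ha).symm⟩
    · rintro ⟨z, hz, hz'⟩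
      have := (ZMod.mem_subgroup_iff_isSquare H hH (Units.mk0 z hz ^ 2)).mpr ⟨z, hz, by simp⟩
      rw [div_eq_iff hs0] at hz'
      rw [hz', ← hmul _ this s] at *
      simpa using hs
  refine ⟨⟨e.symm.trans (Equiv.divRight₀ s hs0), fun {a b} => ?_⟩⟩
  obtain ⟨x, rfl⟩ := e.surjective a
  obtain ⟨y, rfl⟩ := e.surjective b
  simp only [paleyGraph, fromRel_adj, Equiv.trans_apply, Equiv.symm_apply_apply,
    Equiv.divRight₀_apply, comap_adj, Function.Embedding.subtype_apply]
  rw [← key, ← key, Γ.adj_comm (e y), or_self, and_iff_right_iff_imp]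
  rintro h hxy
  rw [div_left_inj' hs0] at hxy
  subst hxy
  exact Γ.irrefl h

theorem SimpleGraph.Connected.exists_is2Geodesic {V : Type*} {Γ : SimpleGraph V}
    (hconn : Γ.Connected) (hnc : Γ ≠ ⊤) : ∃ v u w, Is2Geodesic Γ v u w := by
  obtain ⟨v, w, hne, hnadj⟩ : ∃ v w, v ≠ w ∧ ¬ Γ.Adj v w := by
    by_contra! h
    exact hnc (eq_top_iff.mpr fun v w hvw => h v w hvw)
  obtain ⟨q, hq⟩ := hconn.exists_walk_length_eq_dist v w
  obtain ⟨x, a, b, h1, h2, h3, h4⟩ := Walk.exists_adj_adj_not_adj_ne hq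
    ((hconn v w).one_lt_dist_of_ne_of_not_adj hne hnadj)
  exact ⟨x, a, b, h1, h2, h4, h3⟩

theorem TwoGeodesicTransitive.exists_triangle {V : Type*} {Γ : SimpleGraph V}
    (h2gt : TwoGeodesicTransitive Γ) (h2at : ¬ TwoArcTransitive Γ) :
    ∃ v u w, Γ.Adj v u ∧ Γ.Adj u w ∧ Γ.Adj v w := by
  by_contra! h
  have hgeo : ∀ {v u w}, Is2Arc Γ v u w → Is2Geodesic Γ v u w := fun ⟨h1, h2, h3⟩ =>
    ⟨h1, h2, h3, h _ _ _ h1 h2⟩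
  exact h2at ⟨h2gt.1, fun _ _ _ _ _ _ h1 h2 => h2gt.2 (hgeo h1) (hgeo h2)⟩

theorem card_local_eq_card_neighborFinset_inter {V : Type*} [Fintype V] [DecidableEq V]
    {Γ : SimpleGraph V} [DecidableRel Γ.Adj] {α : Type*} {u : V} (e : α ≃ Γ.neighborSet u)
    (a : α) : Nat.card {x // Γ.Adj (e a) (e x)} =
      (Γ.neighborFinset u ∩ Γ.neighborFinset (e a)).card := by
  have hmem : ∀ v, v ∈ Γ.neighborFinset u ∩ Γ.neighborFinset (e a) ↔
      Γ.Adj u v ∧ Γ.Adj (e a) v := by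
    simp
  rw [← Nat.card_eq_finsetCard]
  exact Nat.card_congr ⟨fun x => ⟨e x, (hmem _).mpr ⟨(e x.1).2, x.2⟩⟩,
    fun y => ⟨e.symm ⟨y, ((hmem _).mp y.2).1⟩, by simpa using ((hmem _).mp y.2).2⟩,
    fun x => Subtype.ext (e.symm_apply_apply _), fun y => by simp⟩

/-- The common neighbourhoods of two vertices at distance two are proper, as otherwise
non-adjacency would be preserved by a nontrivial translation of the local graph. -/
theorem card_neighborFinset_inter_ne {V : Type*} [Fintype V] [DecidableEq V]
    {Γ : SimpleGraph V} [DecidableRel Γ.Adj] {p : ℕ} [Fact p.Prime] {u : V}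
    (hreg : ∀ v, (Γ.neighborFinset v).card = p) (e : ZMod p ≃ Γ.neighborSet u)
    (he : ∀ x y z, Γ.Adj (e (x + z)) (e (y + z)) ↔ Γ.Adj (e x) (e y))
    (hadj : ∃ x, Γ.Adj (e 0) (e x)) {y : ZMod p} (hy : y ≠ 0) (hy' : ¬ Γ.Adj (e 0) (e y)) {c : ℕ}
    (hc : ∀ v u w, Is2Geodesic Γ v u w → (Γ.neighborFinset v ∩ Γ.neighborFinset w).card = c) :
    c ≠ p := by
  rintro rfl
  have hstep : ∀ x, Γ.neighborFinset (e (x + y)) = Γ.neighborFinset (e x) := by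
    intro x
    have h := hc (e x) u (e (x + y)) ⟨(e x).2.symm, (e (x + y)).2, fun h => hy ?_, ?_⟩
    · have h1 := Finset.eq_of_subset_of_card_le Finset.inter_subset_left
        (((hreg (e x)).trans h.symm).le)
      have h2 := Finset.eq_of_subset_of_card_le Finset.inter_subset_right
        (((hreg (e (x + y))).trans h.symm).le)
      exact h2.symm.trans h1
    · exact left_eq_add.mp (e.injective (Subtype.ext h))
    · have := he 0 y x
      rwa [zero_add, add_comm y, iff_false_right hy'] at this
  have hiter : ∀ n : ℕ, Γ.neighborFinset (e (n * y)) = Γ.neighborFinset (e 0) := by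
    intro n
    induction n with
    | zero => rw [Nat.cast_zero, zero_mul]
    | succ n ih => rw [Nat.cast_succ, add_mul, one_mul, hstep, ih]
  obtain ⟨x, hx⟩ := hadj
  have h := hiter (x / y).val
  rw [ZMod.natCast_zmod_val, div_mul_cancel₀ _ hy] at h
  rw [← mem_neighborFinset, ← h, mem_neighborFinset] at hx
  exact Γ.irrefl hx

/-- The numerical constraints on the valencies `k`, `m` of the local graph and of its complement,
and on the number `c` of common neighbours of two vertices at distance two. -/
theorem two_mul_add_one_eq_of_local_constraints {p k m c t : ℕ} (hp : p.Prime)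
    (hkm : k + m + 1 = p) (hk : 0 < k) (hm : 0 < m) (hdvd : m ∣ p - 1) (hc : c ≤ p) (hcp : c ≠ p)
    (hcount : p * m = t * c) (hlow : k + k + 3 ≤ p + c) : 2 * m + 1 = p := by
  have hc0 : 0 < c := by
    rcases Nat.eq_zero_or_pos c with rfl | h
    · rw [mul_zero] at hcount
      exact absurd hcount (Nat.mul_pos hp.pos hm).ne'
    · exact h
  have hpt : p ∣ t := (hp.dvd_mul.mp (Dvd.intro _ hcount)).resolve_right
    fun h => absurd (Nat.le_of_dvd hc0 h) (by omega)
  obtain ⟨s, rfl⟩ := hpt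
  rw [mul_assoc] at hcount
  have hcm : c ≤ m :=
    Nat.le_of_dvd hm (Dvd.intro_left s (Nat.eq_of_mul_eq_mul_left hp.pos hcount).symm)
  obtain ⟨r, hr⟩ := hdvd
  have hr3 : r < 3 := by
    by_contra! h
    have := Nat.mul_le_mul_left m h
    omega
  interval_cases r <;> omega

theorem stmt10 {V : Type*} [Fintype V] (Γ : SimpleGraph V) (p : ℕ)
    (hp : p.Prime) [Fact p.Prime]
    (hreg : ∀ v : V, Nat.card (Γ.neighborSet v) = p)
    (hconn : Γ.Connected)
    (hnc : Γ ≠ ⊤)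
    (h2gt : TwoGeodesicTransitive Γ)
    (h2at : ¬ TwoArcTransitive Γ) :
    ∀ u : V, Nonempty ((SimpleGraph.induce (Γ.neighborSet u) Γ) ≃g paleyGraph (ZMod p)) := by
  classical
  intro u
  have hreg' : ∀ v, (Γ.neighborFinset v).card = p := fun v => by
    rw [← hreg v, Nat.card_eq_fintype_card, card_neighborSet_eq_degree,
      card_neighborFinset_eq_degree]
  obtain ⟨e, he⟩ := h2gt.1.exists_local_coordinates (hreg u)
  have hadj : ∃ x, Γ.Adj (e 0) (e x) := by
    obtain ⟨v, u', w, h1, h2, h3⟩ := h2gt.exists_triangle h2at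
    obtain ⟨φ, hv, hu⟩ := h2gt.1 h1 (e 0).2.symm
    have hw : Γ.Adj u (φ w) := hu ▸ φ.map_adj_iff.mpr h2
    exact ⟨e.symm ⟨φ w, hw⟩, by simpa [← hv, φ.map_adj_iff] using h3⟩
  have hnadj : ∃ x, x ≠ 0 ∧ ¬ Γ.Adj (e 0) (e x) := by
    obtain ⟨v, u', w, h1, h2, h3, h4⟩ := hconn.exists_is2Geodesic hnc
    obtain ⟨φ, hv, hu⟩ := h2gt.1 h1 (e 0).2.symm
    have hw : Γ.Adj u (φ w) := hu ▸ φ.map_adj_iff.mpr h2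
    refine ⟨e.symm ⟨φ w, hw⟩, fun h => h3 (φ.injective ?_), ?_⟩
    · rw [hv, ← h, Equiv.apply_symm_apply]
    · simpa [← hv, φ.map_adj_iff] using h4
  obtain ⟨H, hmul, htrans⟩ := exists_subgroup_of_local_coordinates h2gt e he hadj hnadj
  obtain ⟨y, hy, hy'⟩ := hnadj
  have hgeo : Is2Geodesic Γ (e 0) u (e y) :=
    ⟨(e 0).2.symm, (e y).2, fun h => hy (e.injective (Subtype.ext h)).symm, hy'⟩
  set k := Nat.card {x // Γ.Adj (e 0) (e x)} with hkdef
  set c := (Γ.neighborFinset (e 0 : V) ∩ Γ.neighborFinset (e y)).card with hcdef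
  have hk : ∀ v w, Γ.Adj v w → (Γ.neighborFinset v ∩ Γ.neighborFinset w).card = k := by
    intro v w h
    obtain ⟨φ, rfl, rfl⟩ := h2gt.1 (e 0).2 h
    rw [φ.card_neighborFinset_inter, hkdef, card_local_eq_card_neighborFinset_inter]
  have hc : ∀ v u w, Is2Geodesic Γ v u w →
      (Γ.neighborFinset v ∩ Γ.neighborFinset w).card = c := by
    intro v u w h
    obtain ⟨φ, rfl, rfl, rfl⟩ := h2gt.2 hgeo h
    rw [φ.card_neighborFinset_inter]
  have hkpos : 0 < k := by
    obtain ⟨x, hx⟩ := hadj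
    exact Nat.card_pos_iff.mpr ⟨⟨x, hx⟩, inferInstance⟩
  have hH : Nat.card H = Nat.card {x // x ≠ 0 ∧ ¬ Γ.Adj (e 0) (e x)} := by
    refine Nat.card_eq_of_bijective (fun a => ⟨a.1 * y, ?_, ?_⟩) ⟨fun a b hab => ?_, ?_⟩
    · exact mul_ne_zero a.1.ne_zero hy
    · rwa [hmul _ a.2]
    · exact Subtype.ext (Units.ext (mul_right_cancel₀ hy (congrArg Subtype.val hab)))
    · rintro ⟨z, hz, hz'⟩
      obtain ⟨a, ha, haz⟩ := htrans y z hy hy' hz hz'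
      exact ⟨⟨a, ha⟩, Subtype.ext haz⟩
  have hkm : k + Nat.card H + 1 = p := by
    rw [hH, hkdef, Nat.card_eq_fintype_card, Nat.card_eq_fintype_card, Fintype.card_subtype,
      Fintype.card_subtype]
    have h1 := Finset.card_filter_add_card_filter_not (s := (Finset.univ : Finset (ZMod p)))
      fun x => Γ.Adj (e 0) (e x)
    have h2 : ({x | x ≠ 0 ∧ ¬ Γ.Adj (e 0) (e x)} : Finset (ZMod p)) =
        ({x | ¬ Γ.Adj (e 0) (e x)} : Finset (ZMod p)).erase 0 := by
      ext x
      simp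
    have h3 : (0 : ZMod p) ∈ ({x | ¬ Γ.Adj (e 0) (e x)} : Finset (ZMod p)) := by simp
    have h4 := Finset.card_erase_add_one h3
    rw [Finset.card_univ, ZMod.card] at h1
    rw [h2]
    omega
  obtain ⟨t, ht⟩ := card_mul_eq_of_is2Geodesic hkm hreg' hk hc u
  have hdvd : Nat.card H ∣ p - 1 := by
    rw [← ZMod.card_units p, ← Nat.card_eq_fintype_card]
    exact H.card_subgroup_dvd_card
  have hcp : c ≤ p := hreg' (e 0) ▸ Finset.card_le_card Finset.inter_subset_left
  have hlow := hgeo.le_card_neighborFinset_inter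
  rw [hk _ _ (e 0).2, hk _ _ (e y).2, hreg'] at hlow
  have hfinal := two_mul_add_one_eq_of_local_constraints hp hkm hkpos Nat.card_pos hdvd hcp
    (card_neighborFinset_inter_ne hreg' e he hadj hy hy' hc) ht hlow
  exact exists_iso_paleyGraph e he H hfinal hmul (by omega)
end

section
/- Let Γ be a finite connected non-complete graph of prime valency p that is 2-geodesic transitive but not 2-arc transitive. Then for every vertex v, if v' is the unique vertex at distance 3 from v, the set of vertices at distance 2 from v equals the neighbourhood of v'; in particular the vertex set of Γ is the disjoint union {v} ∪ Γ(v) ∪ Γ(v') ∪ {v'}. -/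
open SimpleGraph

section

open Polynomial Finset

/-- Some power sum of a nonempty set of nonzero elements is nonzero. -/
theorem exists_powerSum_ne_zero {p : ℕ} [Fact p.Prime] (U : Finset (ZMod p)) (h0 : 0 ∉ U)
    (hU : U.Nonempty) : ∃ r, 1 ≤ r ∧ r ≤ #U ∧ ∑ u ∈ U, u ^ r ≠ 0 := by
  by_contra! hs
  have hcard : (#U : ZMod p) ≠ 0 := by
    rw [Ne, ZMod.natCast_eq_zero_iff]
    intro hd
    have h1 := Nat.le_of_dvd hU.card_pos hd
    have h2 : #U < #(univ : Finset (ZMod p)) :=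
      card_lt_card ((ssubset_univ_iff).2 fun h => h0 (h ▸ mem_univ _))
    rw [card_univ, ZMod.card] at h2
    omega
  set P : (ZMod p)[X] := ∏ u ∈ U, (X - C u) with hP
  have hdeg : P.natDegree = #U := by
    rw [hP, natDegree_prod_of_monic _ _ fun u _ => monic_X_sub_C u]; simp
  have h1 : ∑ u ∈ U, P.eval u = 0 := sum_eq_zero fun u hu => by
    rw [hP, eval_prod]; exact prod_eq_zero hu (by simp)
  simp_rw [eval_eq_sum_range] at h1
  rw [sum_comm] at h1
  simp_rw [← mul_sum] at h1
  rw [sum_eq_single 0] at h1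
  · simp only [pow_zero, sum_const, nsmul_eq_mul, mul_one, mul_eq_zero, hcard, or_false] at h1
    rw [coeff_zero_eq_eval_zero, hP, eval_prod, prod_eq_zero_iff] at h1
    obtain ⟨u, hu, h⟩ := h1
    have : u = 0 := by simpa using h
    exact h0 (this ▸ hu)
  · intro b hb hb0
    rw [hs b (by omega) (by rw [mem_range] at hb; omega), mul_zero]
  · simp

/-- Müller's lemma: a map of `ZMod p` carrying each `i + U` into `π i + U` is affine. -/
theorem affine_of_preserves_differences {p : ℕ} [Fact p.Prime] (U : Finset (ZMod p))
    (h0 : 0 ∉ U) (hU : U.Nonempty) (hsum : ∑ u ∈ U, u = 0) (hcard : 2 * #U ≤ p - 1)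
    (π : ZMod p → ZMod p) (hinj : Function.Injective π)
    (hπ : ∀ i, ∀ u ∈ U, π (i + u) - π i ∈ U) :
    ∃ a b, ∀ i, π i = a * i + b := by
  classical
  have hex := exists_powerSum_ne_zero U h0 hU
  obtain ⟨hr1, hrU, hrs⟩ := Nat.find_spec hex
  have hmin := fun k => Nat.find_min (m := k) hex
  set r := Nat.find hex
  have hs : ∀ j, 1 ≤ j → j < r → ∑ u ∈ U, u ^ j = 0 := fun j h1 h2 => by
    by_contra h
    exact hmin j h2 ⟨h1, by omega, h⟩
  have hr2 : 2 ≤ r := by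
    by_contra h
    have : r = 1 := by omega
    rw [this] at hrs
    simp [hsum] at hrs
  have hshift : ∀ i, ∀ g : ZMod p → ZMod p,
      ∑ u ∈ U, g (π (i + u)) = ∑ u ∈ U, g (π i + u) := by
    intro i g
    have himg : U.image (fun u => π (i + u) - π i) = U := by
      apply eq_of_subset_of_card_le
      · intro x hx
        obtain ⟨u, hu, rfl⟩ := mem_image.1 hx
        exact hπ i u hu
      · rw [card_image_of_injective]
        intro x y hxy
        simpa using hinj (sub_left_injective hxy)
    conv_rhs => rw [← himg]
    rw [sum_image]
    · simp
    · intro x _ y _ hxy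
      simpa using hinj (sub_left_injective hxy)
  set P : (ZMod p)[X] := Lagrange.interpolate univ id π with hP
  have hPe : ∀ i, P.eval i = π i := fun i =>
    Lagrange.eval_interpolate_at_node (v := id) π (Function.injective_id.injOn) (mem_univ i)
  have hp1 : 1 < p := (Fact.out : p.Prime).one_lt
  have hPd : P.natDegree < p := by
    rcases eq_or_ne P 0 with h | h
    · rw [h]; simp; omega
    · rw [natDegree_lt_iff_degree_lt h]
      have h' := Lagrange.degree_interpolate_lt (v := id) π
        (s := (univ : Finset (ZMod p))) Function.injective_id.injOn
      rwa [card_univ, ZMod.card] at h'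
  set n := P.natDegree with hn
  by_cases hn1 : n ≤ 1
  · obtain ⟨a, b, hab⟩ := exists_eq_X_add_C_of_natDegree_le_one hn1
    exact ⟨a, b, fun i => by rw [← hPe, hab]; simp⟩
  exfalso
  obtain ⟨m, hm1, hmr, hrm, hmp⟩ : ∃ m, 1 ≤ m ∧ m < r ∧ r ≤ n * m ∧ n * m < p := by
    by_cases hnr : r ≤ n
    · exact ⟨1, le_rfl, hr2, by omega, by omega⟩
    · refine ⟨(r + n - 1) / n, ?_, ?_, ?_, ?_⟩
      · rw [Nat.le_div_iff_mul_le (by omega)]; omega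
      · rw [Nat.div_lt_iff_lt_mul (by omega)]
        obtain ⟨a, ha⟩ := Nat.exists_eq_add_of_le hr2
        obtain ⟨b, hb⟩ := Nat.exists_eq_add_of_le (show 2 ≤ n by omega)
        rw [ha, hb]
        have : (2 + a) * (2 + b) = a * b + 2 * a + 2 * b + 4 := by ring
        omega
      · have := Nat.lt_mul_div_succ (r + n - 1) (show 0 < n by omega)
        rw [mul_add] at this; omega
      · have := Nat.mul_div_le (r + n - 1) n
        omega
  set Q := P ^ m with hQ
  have hQd : Q.natDegree = n * m := by rw [hQ, natDegree_pow, mul_comm]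
  have hQ0 : Q ≠ 0 := pow_ne_zero _ fun h => by rw [hn, h] at hn1; simp at hn1
  have hzero : ∑ u ∈ U, taylor u Q - (#U : (ZMod p)[X]) * Q = 0 := by
    apply eq_zero_of_natDegree_lt_card_of_eval_eq_zero _ (f := (id : ZMod p → ZMod p))
      Function.injective_id
    · intro i
      rw [eval_sub, eval_finsetSum]
      simp only [id, taylor_eval, hQ, eval_pow, hPe, eval_mul, eval_natCast]
      have := hshift i (fun x => x ^ m)
      rw [this]
      simp_rw [add_comm (π i), add_pow]
      rw [sum_comm, sum_eq_single 0]
      · simp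
      · intro b hb hb0
        rw [mem_range] at hb
        rw [← sum_mul, ← sum_mul, hs b (by omega) (by omega)]; simp
      · simp
    · rw [ZMod.card]
      refine (natDegree_sub_le_of_le (m := n * m) (n := n * m) ?_ ?_).trans_lt (by simpa using hmp)
      · exact natDegree_sum_le_of_forall_le _ _ fun u _ => by rw [natDegree_taylor, hQd]
      · rw [← map_natCast C]
        exact (natDegree_C_mul_le _ _).trans hQd.le
  have hc := congrArg (fun R => coeff R (n * m - r)) hzero
  simp only [coeff_sub, finsetSum_coeff, taylor_coeff, coeff_zero] at hc
  set k := n * m - r with hk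
  have hD : (hasseDeriv k Q).natDegree < r + 1 := by
    have := natDegree_hasseDeriv_le Q k
    omega
  simp_rw [eval_eq_sum_range' hD] at hc
  rw [sum_comm] at hc
  simp_rw [← mul_sum] at hc
  rw [sum_range_succ, sum_range_eq_add_Ico _ (by omega : 0 < r), sum_eq_zero (s := Ico 1 r)] at hc
  · rw [← map_natCast C, coeff_C_mul] at hc
    simp only [hasseDeriv_coeff] at hc
    have hrk : r + k = n * m := by omega
    rw [hrk] at hc
    simp only [zero_add, Nat.choose_self, Nat.cast_one, one_mul, pow_zero, sum_const, nsmul_eq_mul,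
      mul_one, add_zero] at hc
    rw [mul_comm (Q.coeff k), add_sub_cancel_left, mul_eq_zero, mul_eq_zero] at hc
    rcases hc with (h | h) | h
    · rw [ZMod.natCast_eq_zero_iff] at h
      have hfac := Nat.choose_mul_factorial_mul_factorial (show k ≤ n * m by omega)
      rw [mul_assoc] at hfac
      exact absurd ((Fact.out : p.Prime).dvd_factorial.1 (hfac ▸ h.mul_right _)) (by omega)
    · rw [← hQd] at h
      exact hQ0 (leadingCoeff_eq_zero.1 h)
    · exact hrs h
  · intro j hj
    rw [mem_Ico] at hj
    rw [hs j hj.1 hj.2, mul_zero]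

theorem exists_zmod_equiv_of_transitive {p : ℕ} [Fact p.Prime] {X : Type*} [Fintype X]
    (hX : Fintype.card X = p) (G : Subgroup (Equiv.Perm X)) (hG : ∀ x y, ∃ g ∈ G, g x = y) :
    ∃ g ∈ G, ∃ e : ZMod p ≃ X, ∀ i, g (e i) = e (i + 1) := by
  classical
  have hp : p.Prime := Fact.out
  have hne : Nonempty X := Fintype.card_pos_iff.1 (hX ▸ hp.pos)
  obtain ⟨x₀⟩ := hne
  have hpre : MulAction.IsPretransitive G X :=
    ⟨fun x y => let ⟨g, hg, h⟩ := hG x y; ⟨⟨g, hg⟩, h⟩⟩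
  have hdvd : p ∣ Nat.card G := by
    have := MulAction.index_stabilizer_of_transitive G x₀
    rw [Nat.card_eq_fintype_card, hX] at this
    exact this ▸ Subgroup.index_dvd_card _
  obtain ⟨⟨g, hgG⟩, hg⟩ := exists_prime_orderOf_dvd_card' p hdvd
  have hg' : orderOf g = p := by rw [← hg, Subgroup.orderOf_mk]
  have hcyc : g.IsCycle := Equiv.Perm.isCycle_of_prime_order'' (hX ▸ hp) (by rw [hg', hX])
  have hsupp : ∀ x, g x ≠ x := by
    have h1 : #g.support = #(univ : Finset X) := by rw [← hcyc.orderOf, hg', card_univ, hX]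
    have h2 := eq_of_subset_of_card_le (subset_univ g.support) h1.ge
    intro x
    rw [← Equiv.Perm.mem_support, h2]
    exact mem_univ x
  have hsurj : Function.Surjective fun i : ZMod p => (g ^ i.val) x₀ := by
    intro y
    obtain ⟨n, hn⟩ := hcyc.exists_pow_eq (hsupp x₀) (hsupp y)
    refine ⟨n, ?_⟩
    simp only [ZMod.val_natCast]
    rw [← hn, ← hg', pow_mod_orderOf]
  refine ⟨g, hgG, Equiv.ofBijective _
    ((Fintype.bijective_iff_surjective_and_card _).2 ⟨hsurj, by rw [ZMod.card, hX]⟩), fun i => ?_⟩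
  simp only [Equiv.ofBijective_apply]
  have : (g ^ (i + 1).val) = g ^ (i.val + 1) := by
    rw [pow_eq_pow_iff_modEq, hg', ← ZMod.natCast_eq_natCast_iff]
    simp
  rw [this, pow_succ']
  rfl

/-- A transitive permutation group of prime degree `p` preserving a graph that is neither complete
nor empty acts affinely on `ZMod p`, and the graph becomes a Cayley graph. -/
theorem exists_affine_coordinates {p : ℕ} [Fact p.Prime] {X : Type*} [Fintype X]
    (hX : Fintype.card X = p) (G : Subgroup (Equiv.Perm X)) (hG : ∀ x y, ∃ g ∈ G, g x = y)
    (Δ : SimpleGraph X) (hΔ : ∀ g ∈ G, ∀ x y, Δ.Adj (g x) (g y) ↔ Δ.Adj x y)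
    (hedge : ∃ x y, Δ.Adj x y) (hnonedge : ∃ x y, x ≠ y ∧ ¬ Δ.Adj x y) :
    ∃ (e : ZMod p ≃ X) (S : Finset (ZMod p)), (0 ∉ S ∧ S.Nonempty ∧ (∃ d, d ≠ 0 ∧ d ∉ S) ∧
      ∀ s, -s ∈ S ↔ s ∈ S) ∧ (∀ i j, Δ.Adj (e i) (e j) ↔ i - j ∈ S) ∧
      ∀ g ∈ G, ∃ a b, ∀ i, g (e i) = e (a * i + b) := by
  classical
  obtain ⟨g, hg, e, he⟩ := exists_zmod_equiv_of_transitive hX G hG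
  have hshift1 : ∀ i j, Δ.Adj (e (i + 1)) (e (j + 1)) ↔ Δ.Adj (e i) (e j) := fun i j => by
    rw [← he, ← he, hΔ g hg]
  have hshift : ∀ (n : ℕ) i j, Δ.Adj (e (i + n)) (e (j + n)) ↔ Δ.Adj (e i) (e j) := by
    intro n i j
    induction n with
    | zero => simp
    | succ n ih => rw [← ih, ← hshift1 (i + n)]; push_cast; simp only [add_assoc]
  set S : Finset (ZMod p) := univ.filter fun d => Δ.Adj (e d) (e 0) with hS
  have hadj : ∀ i j, Δ.Adj (e i) (e j) ↔ i - j ∈ S := fun i j => by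
    rw [hS, mem_filter, ← hshift j.val (i - j) 0]
    simp
  have h0 : 0 ∉ S := by simp [hS]
  have hneg : ∀ s, -s ∈ S ↔ s ∈ S := fun s => by
    have h1 := hadj 0 s
    have h2 := hadj s 0
    rw [zero_sub] at h1
    rw [sub_zero] at h2
    rw [← h1, ← h2, Δ.adj_comm]
  obtain ⟨x, y, hxy⟩ := hedge
  obtain ⟨i, rfl⟩ := e.surjective x
  obtain ⟨j, rfl⟩ := e.surjective y
  obtain ⟨x, y, hne, hxy'⟩ := hnonedge
  obtain ⟨k, rfl⟩ := e.surjective x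
  obtain ⟨l, rfl⟩ := e.surjective y
  have hSne : S.Nonempty := ⟨_, (hadj i j).1 hxy⟩
  have hkl : k - l ≠ 0 ∧ k - l ∉ S :=
    ⟨sub_ne_zero.2 fun h => hne (h ▸ rfl), fun h => hxy' ((hadj _ _).2 h)⟩
  refine ⟨e, S, ⟨h0, hSne, ⟨_, hkl⟩, hneg⟩, hadj, fun g hg => ?_⟩
  set T : Finset (ZMod p) := univ.filter fun d => d ≠ 0 ∧ d ∉ S with hT
  have hTmem : ∀ d, d ∈ T ↔ d ≠ 0 ∧ d ∉ S := fun d => by simp [hT]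
  have hcard : #S + #T = p - 1 := by
    have hd : Disjoint S T := Finset.disjoint_left.2 fun x h1 h2 => ((hTmem x).1 h2).2 h1
    rw [← card_union_of_disjoint hd]
    have : S ∪ T = univ.erase 0 := by
      ext x
      simp only [mem_union, hTmem, mem_erase, mem_univ, and_true]
      constructor
      · rintro (h | h)
        · rintro rfl; exact h0 h
        · exact h.1
      · tauto
    rw [this, card_erase_of_mem (mem_univ _), card_univ, ZMod.card]
  have hp2 : p ≠ 2 := by
    have h1 : 0 < #S := hSne.card_pos
    have h2 : 0 < #T := card_pos.2 ⟨_, (hTmem _).2 hkl⟩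
    omega
  have hsum : ∀ W : Finset (ZMod p), (∀ s ∈ W, -s ∈ W) → ∑ u ∈ W, u = 0 := by
    intro W hW
    have h1 : ∑ u ∈ W, u = ∑ u ∈ W, -u :=
      sum_bij (fun u _ => -u) hW (fun _ _ _ _ h => neg_injective h)
        (fun b hb => ⟨-b, hW b hb, neg_neg b⟩) (fun _ _ => (neg_neg _).symm)
    rw [sum_neg_distrib, eq_comm, ZMod.neg_eq_self_iff] at h1
    refine h1.resolve_right fun h => ?_
    have := (Fact.out : p.Prime).eq_one_or_self_of_dvd 2 ⟨_, h.symm⟩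
    omega
  set π : ZMod p → ZMod p := fun i => e.symm (g (e i)) with hπ
  have hinj : Function.Injective π := e.symm.injective.comp (g.injective.comp e.injective)
  have hπS : ∀ i j, π i - π j ∈ S ↔ i - j ∈ S := fun i j => by
    rw [← hadj, ← hadj, hπ]; simp [hΔ g hg]
  suffices h : ∃ a b, ∀ i, π i = a * i + b by
    obtain ⟨a, b, h⟩ := h
    exact ⟨a, b, fun i => by rw [← h]; simp [hπ]⟩
  rcases le_total #S #T with hle | hle
  · refine affine_of_preserves_differences S h0 hSne (hsum S fun s hs => (hneg s).2 hs)
      (by omega) π hinj fun i u hu => ?_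
    rw [hπS]; simpa using hu
  · refine affine_of_preserves_differences T (fun h => ((hTmem 0).1 h).1 rfl)
      ⟨_, (hTmem _).2 hkl⟩ (hsum T fun s hs => ?_) (by omega) π hinj fun i u hu => ?_
    · rw [hTmem] at hs ⊢
      rwa [neg_ne_zero, hneg]
    · rw [hTmem] at hu ⊢
      rw [hπS, sub_ne_zero, hinj.ne_iff]
      simpa using hu

/-- The nonzero elements outside `S`. -/
def nonzeroCompl {p : ℕ} [Fact p.Prime] (S : Finset (ZMod p)) : Finset (ZMod p) :=
  univ.filter fun d => d ≠ 0 ∧ d ∉ S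

/-- `S` is a symmetric set of nonzero elements of `ZMod p`, proper and nonempty, such that the
multipliers preserving `S` are transitive on the nonzero elements outside `S`. -/
structure IsCyclotomic {p : ℕ} [Fact p.Prime] (S : Finset (ZMod p)) : Prop where
  zero_notMem : 0 ∉ S
  nonempty : S.Nonempty
  exists_notMem : ∃ d, d ≠ 0 ∧ d ∉ S
  neg_mem : ∀ s, -s ∈ S ↔ s ∈ S
  trans : ∀ x y, x ≠ 0 → x ∉ S → y ≠ 0 → y ∉ S → ∃ a, a * x = y ∧ ∀ s, a * s ∈ S ↔ s ∈ S

theorem mem_nonzeroCompl {p : ℕ} [Fact p.Prime] {S : Finset (ZMod p)} {d : ZMod p} :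
    d ∈ nonzeroCompl S ↔ d ≠ 0 ∧ d ∉ S := by simp [nonzeroCompl]

namespace IsCyclotomic

variable {p : ℕ} [Fact p.Prime] {S : Finset (ZMod p)}

theorem disjoint (_ : IsCyclotomic S) : Disjoint S (nonzeroCompl S) :=
  Finset.disjoint_left.2 fun _ h1 h2 => (mem_nonzeroCompl.1 h2).2 h1

theorem union_eq (h : IsCyclotomic S) : S ∪ nonzeroCompl S = univ.erase 0 := by
  ext x
  have := h.zero_notMem
  simp only [mem_union, mem_nonzeroCompl, mem_erase, mem_univ, and_true]
  grind

theorem card_add_card (h : IsCyclotomic S) : #S + #(nonzeroCompl S) = p - 1 := by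
  rw [← card_union_of_disjoint h.disjoint, h.union_eq, card_erase_of_mem (mem_univ _), card_univ,
    ZMod.card]

theorem card_nonzeroCompl_dvd (h : IsCyclotomic S) : #(nonzeroCompl S) ∣ p - 1 := by
  classical
  obtain ⟨d, hd0, hdS⟩ := h.exists_notMem
  let H : Subgroup (ZMod p)ˣ :=
    { carrier := {a | ∀ s, (a : ZMod p) * s ∈ S ↔ s ∈ S}
      one_mem' := by simp
      mul_mem' := fun {a b} ha hb s => by
        rw [Units.val_mul, mul_assoc, ha, hb]
      inv_mem' := fun {a} ha s => by
        rw [← ha, ← mul_assoc, ← Units.val_mul, mul_inv_cancel, Units.val_one, one_mul] }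
  have hH : Nat.card H = #(nonzeroCompl S) := by
    rw [← Nat.card_eq_finsetCard]
    refine Nat.card_congr (Equiv.ofBijective
      (fun a => ⟨(a : (ZMod p)ˣ) * d, mem_nonzeroCompl.2 ⟨mul_ne_zero a.1.ne_zero hd0,
        fun hs => hdS ((a.2 d).1 hs)⟩⟩) ⟨fun a b hab => ?_, fun y => ?_⟩)
    · simp only [Subtype.mk.injEq, mul_eq_mul_right_iff, hd0, or_false] at hab
      exact Subtype.ext (Units.ext hab)
    · obtain ⟨y, hy⟩ := y
      rw [mem_nonzeroCompl] at hy
      obtain ⟨a, ha, haS⟩ := h.trans d y hd0 hdS hy.1 hy.2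
      have ha0 : a ≠ 0 := by rintro rfl; exact hy.1 (by rw [← ha, zero_mul])
      exact ⟨⟨Units.mk0 a ha0, haS⟩, Subtype.ext ha⟩
  rw [← hH, ← ZMod.card_units p, ← Nat.card_eq_fintype_card]
  exact Subgroup.card_subgroup_dvd_card H

/-- If the two parts have equal size then some multiplier swaps them. -/
theorem exists_swap (h : IsCyclotomic S) (hc : #S = #(nonzeroCompl S)) :
    ∃ t : ZMod p, t ≠ 0 ∧ ∀ s, s ≠ 0 → (t * s ∈ S ↔ s ∉ S) := by
  classical
  obtain ⟨d, hd0, hdS⟩ := h.exists_notMem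
  obtain ⟨s₀, hs₀⟩ := h.nonempty
  have hs₀0 : s₀ ≠ 0 := fun h' => h.zero_notMem (h' ▸ hs₀)
  set t := s₀ / d with ht
  have ht0 : t ≠ 0 := div_ne_zero hs₀0 hd0
  have himg : (nonzeroCompl S).image (t * ·) = S := by
    apply eq_of_subset_of_card_le
    · intro y hy
      obtain ⟨x, hx, rfl⟩ := mem_image.1 hy
      rw [mem_nonzeroCompl] at hx
      obtain ⟨a, ha, haS⟩ := h.trans d x hd0 hdS hx.1 hx.2
      have : t * x = a * s₀ := by rw [← ha, ht]; field_simp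
      simp only [this, haS, hs₀]
    · rw [card_image_of_injective _ (mul_right_injective₀ ht0), hc]
  refine ⟨t, ht0, fun s hs => ?_⟩
  conv_lhs => rw [← himg]
  rw [mem_image]
  constructor
  · rintro ⟨x, hx, hxs⟩
    rw [← mul_right_injective₀ ht0 hxs]
    exact (mem_nonzeroCompl.1 hx).2
  · exact fun h' => ⟨s, mem_nonzeroCompl.2 ⟨hs, h'⟩, rfl⟩

theorem trans_mem (h : IsCyclotomic S) (hc : #S = #(nonzeroCompl S)) {x y : ZMod p}
    (hx : x ∈ S) (hy : y ∈ S) : ∃ a, a * x = y ∧ ∀ s, a * s ∈ S ↔ s ∈ S := by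
  obtain ⟨t, ht0, ht⟩ := h.exists_swap hc
  have key : ∀ z ∈ S, t⁻¹ * z ≠ 0 ∧ t⁻¹ * z ∉ S := fun z hz => by
    have hz0 : t⁻¹ * z ≠ 0 :=
      mul_ne_zero (inv_ne_zero ht0) fun h' => h.zero_notMem (h' ▸ hz)
    exact ⟨hz0, (ht _ hz0).1 (by rwa [mul_inv_cancel_left₀ ht0])⟩
  obtain ⟨a, ha, haS⟩ := h.trans _ _ (key x hx).1 (key x hx).2 (key y hy).1 (key y hy).2
  refine ⟨a, ?_, haS⟩
  rw [mul_left_comm] at ha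
  exact mul_left_cancel₀ (inv_ne_zero ht0) ha

/-- In the Paley case, `d ∉ S` is a difference of elements of `S` in exactly `#S / 2` ways. -/
theorem two_mul_card_differences (h : IsCyclotomic S) (hc : #S = #(nonzeroCompl S)) {d : ZMod p}
    (hd0 : d ≠ 0) (hdS : d ∉ S) : 2 * #(S.filter fun x => x - d ∈ S) = #S := by
  classical
  obtain ⟨t, ht0, ht⟩ := h.exists_swap hc
  set U := nonzeroCompl S with hU
  have hneg : ∀ x, x - d ∈ S ↔ d - x ∈ S := fun x => by rw [← h.neg_mem, neg_sub]
  set c := #(S.filter fun x => x - d ∈ S) with hcdef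
  have hc1 : ∀ a, (∀ s, a * s ∈ S ↔ s ∈ S) → a ≠ 0 →
      ∀ e, #(S.filter fun x => x - a * e ∈ S) = #(S.filter fun x => x - e ∈ S) := by
    intro a ha ha0 e
    symm
    refine card_bij (fun x _ => a * x) (fun x hx => ?_)
      (fun x _ y _ hxy => mul_left_cancel₀ ha0 hxy) (fun y hy => ⟨a⁻¹ * y, ?_, ?_⟩)
    · rw [mem_filter] at hx ⊢
      rw [← mul_sub, ha, ha]; exact hx
    · rw [mem_filter] at hy ⊢
      rw [← ha, ← ha (_ - _), mul_sub, mul_inv_cancel_left₀ ha0]; exact hy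
    · exact mul_inv_cancel_left₀ ha0 y
  have hcU : ∀ e ∈ U, #(S.filter fun x => x - e ∈ S) = c := by
    intro e he
    rw [hU, mem_nonzeroCompl] at he
    obtain ⟨a, ha, haS⟩ := h.trans d e hd0 hdS he.1 he.2
    rw [← ha, hc1 a haS (by rintro rfl; exact he.1 (by rw [← ha, zero_mul]))]
  have h1 : #(S.filter fun x => x - d ∈ S) + #(S.filter fun x => x - d ∈ U) = #S := by
    rw [← card_filter_add_card_filter_not (s := S) (fun x => x - d ∈ S)]
    congr 2
    ext x
    simp only [mem_filter, hU, mem_nonzeroCompl, sub_ne_zero]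
    have : x ∈ S → x ≠ d := fun hx hxd => hdS (hxd ▸ hx)
    tauto
  have h2 : #(U.filter fun x => x - d ∈ U) + #(U.filter fun x => x - d ∈ S) + 1 = #U := by
    have hdU : d ∈ U := by rw [hU, mem_nonzeroCompl]; exact ⟨hd0, hdS⟩
    rw [← card_erase_add_one hdU,
      ← card_filter_add_card_filter_not (s := U.erase d) (fun x => x - d ∈ U)]
    congr 3
    · ext x
      simp only [mem_filter, mem_erase, hU, mem_nonzeroCompl, sub_ne_zero]
      tauto
    · ext x
      have h0 := h.zero_notMem
      simp only [mem_filter, mem_erase, hU, mem_nonzeroCompl, sub_ne_zero]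
      have : x - d ∈ S → x ≠ d := fun hx hxd => h0 (by rwa [hxd, sub_self] at hx)
      tauto
  have h3 : #(U.filter fun x => x - d ∈ S) = #(S.filter fun x => x - d ∈ U) := by
    refine card_bij (fun x _ => d - x) (fun x hx => ?_) (fun x _ y _ hxy => sub_right_injective hxy)
      (fun y hy => ⟨d - y, ?_, sub_sub_cancel d y⟩)
    · simp only [mem_filter, hU, mem_nonzeroCompl] at hx ⊢
      rw [← hneg, sub_sub_cancel_left, neg_ne_zero, h.neg_mem]
      exact ⟨hx.2, hx.1⟩
    · simp only [mem_filter, hU, mem_nonzeroCompl] at hy ⊢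
      rw [← hneg, sub_sub_cancel_left, h.neg_mem, ← neg_ne_zero, neg_sub]
      exact ⟨hy.2, hy.1⟩
  have hswap : ∀ s, t * s ∈ U ↔ s ∈ S := fun s => by
    rcases eq_or_ne s 0 with rfl | hs
    · simp [hU, mem_nonzeroCompl, h.zero_notMem]
    · rw [hU, mem_nonzeroCompl, ht s hs, not_not]
      simp [ht0, hs]
  have hswap' : ∀ s, t * s ∈ S ↔ s ∈ U := fun s => by
    rcases eq_or_ne s 0 with rfl | hs
    · simp [hU, mem_nonzeroCompl, h.zero_notMem]
    · rw [hU, mem_nonzeroCompl, ht s hs]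
      simp [hs]
  have h4 : #(U.filter fun x => x - d ∈ U) = #(S.filter fun x => x - t * d ∈ S) := by
    refine card_bij (fun x _ => t * x) (fun x hx => ?_)
      (fun x _ y _ hxy => mul_left_cancel₀ ht0 hxy) (fun y hy => ⟨t⁻¹ * y, ?_, ?_⟩)
    · rw [mem_filter] at hx ⊢
      rw [← mul_sub, hswap', hswap']; exact hx
    · rw [mem_filter] at hy ⊢
      rw [← hswap', ← hswap' (_ - _), mul_sub, mul_inv_cancel_left₀ ht0]; exact hy
    · exact mul_inv_cancel_left₀ ht0 y
  have htd : t * d ∈ S := (ht d hd0).2 hdS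
  have hcS : ∀ e ∈ S, #(S.filter fun x => x - e ∈ S) + 1 = c := by
    intro e he
    obtain ⟨a, ha, haS⟩ := h.trans_mem hc htd he
    rw [← ha, hc1 a haS, ← h4]
    · omega
    · rintro rfl
      rw [zero_mul] at ha
      exact h.zero_notMem (ha ▸ he)
  have h5 : ∑ e ∈ S ∪ U, #(S.filter fun x => x - e ∈ S) = #S * (#S - 1) := by
    rw [h.union_eq]
    simp_rw [card_filter]
    rw [sum_comm, ← smul_eq_mul, ← sum_const]
    refine sum_congr rfl fun x hx => ?_
    rw [← card_filter, ← card_erase_of_mem hx]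
    refine card_bij (fun e _ => x - e) (fun e he => ?_) (fun e _ e' _ hee => sub_right_injective hee)
      (fun y hy => ⟨x - y, ?_, sub_sub_cancel x y⟩)
    · simp only [mem_filter, mem_erase, mem_univ, and_true] at he ⊢
      exact ⟨by simpa using he.1, he.2⟩
    · simp only [mem_filter, mem_erase, mem_univ, and_true, sub_sub_cancel] at hy ⊢
      exact ⟨sub_ne_zero.2 hy.1.symm, hy.2⟩
  rw [sum_union h.disjoint, sum_congr rfl hcU, sum_const, smul_eq_mul, ← hc] at h5
  have h6 : ∑ e ∈ S, (#(S.filter fun x => x - e ∈ S) + 1) = #S * c := by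
    rw [sum_congr rfl hcS, sum_const, smul_eq_mul]
  rw [sum_add_distrib, sum_const, smul_eq_mul, mul_one] at h6
  have hpos : 0 < #S := h.nonempty.card_pos
  apply Nat.eq_of_mul_eq_mul_left hpos
  obtain ⟨k, hk⟩ := Nat.exists_eq_add_of_lt hpos
  rw [zero_add] at hk
  rw [hk] at h5 h6 ⊢
  rw [Nat.add_sub_cancel] at h5
  linarith

theorem exists_sub_mem (h : IsCyclotomic S) (hc : #S = #(nonzeroCompl S)) :
    ∃ s d, s ∈ S ∧ d ≠ 0 ∧ d ∉ S ∧ s - d ∈ S := by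
  obtain ⟨d, hd0, hdS⟩ := h.exists_notMem
  have h1 := h.two_mul_card_differences hc hd0 hdS
  have h2 := h.nonempty.card_pos
  obtain ⟨s, hs⟩ := card_pos.1 (show 0 < #(S.filter fun x => x - d ∈ S) by omega)
  exact ⟨s, d, (mem_filter.1 hs).1, hd0, hdS, (mem_filter.1 hs).2⟩

/-- An affine group with multipliers preserving `S`, transitive on a set `C` of `#S` points, fixes
the centroid `f` of `C`; the set `C` is a translate of `S` or of its complement, and the
group is transitive on the remaining points. -/
theorem exists_center (h : IsCyclotomic S) (hc : #S = #(nonzeroCompl S)) (C : Finset (ZMod p))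
    (hC : #C = #S) (K : ZMod p → ZMod p → Prop) (hK : ∀ a b, K a b → ∀ s, a * s ∈ S ↔ s ∈ S)
    (hKC : ∀ a b, K a b → ∀ x ∈ C, a * x + b ∈ C)
    (htrans : ∀ x ∈ C, ∀ y ∈ C, ∃ a b, K a b ∧ a * x + b = y) :
    ∃ f, ((∀ x, x ∈ C ↔ x - f ∈ S) ∨ ∀ x, x ∈ C ↔ x - f ≠ 0 ∧ x - f ∉ S) ∧
      ∀ x y, x ∉ C → x ≠ f → y ∉ C → y ≠ f → ∃ a b, K a b ∧ a * x + b = y := by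
  classical
  have hcard := h.card_add_card
  have hpos : 0 < #S := h.nonempty.card_pos
  have hm0 : (#C : ZMod p) ≠ 0 := by
    rw [hC, Ne, ZMod.natCast_eq_zero_iff]
    intro hd
    have := Nat.le_of_dvd hpos hd
    omega
  have hne0 : ∀ a b, K a b → a ≠ 0 := by
    rintro a b hab rfl
    obtain ⟨s, hs⟩ := h.nonempty
    have := (hK _ _ hab s).2 hs
    rw [zero_mul] at this
    exact h.zero_notMem this
  set f := (∑ x ∈ C, x) / #C with hf
  have hfix : ∀ a b, K a b → a * f + b = f := by
    intro a b hab
    have himg : C.image (fun x => a * x + b) = C := by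
      apply eq_of_subset_of_card_le
      · intro y hy
        obtain ⟨x, hx, rfl⟩ := mem_image.1 hy
        exact hKC a b hab x hx
      · rw [card_image_of_injective]
        intro x y hxy
        exact mul_left_cancel₀ (hne0 a b hab) (add_right_cancel hxy)
    have h1 : ∑ x ∈ C, x = a * ∑ x ∈ C, x + #C * b := by
      conv_lhs => rw [← himg]
      rw [sum_image]
      · rw [sum_add_distrib, mul_sum, sum_const, nsmul_eq_mul]
      · intro x _ y _ hxy
        exact mul_left_cancel₀ (hne0 a b hab) (add_right_cancel hxy)
    rw [hf, eq_div_iff hm0, add_mul, mul_assoc, div_mul_cancel₀ _ hm0]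
    linear_combination -h1
  have hact : ∀ a b, K a b → ∀ x, a * x + b - f = a * (x - f) := fun a b hab x => by
    linear_combination hfix a b hab
  obtain ⟨c₀, hc₀⟩ : C.Nonempty := card_pos.1 (hC ▸ hpos)
  have hcoset : ∀ x ∈ C, x - f ∈ S ↔ c₀ - f ∈ S := by
    intro x hx
    obtain ⟨a, b, hab, rfl⟩ := htrans c₀ hc₀ x hx
    rw [hact a b hab, hK a b hab]
  have hfC : f ∉ C := by
    intro hfC
    have h1 : #C ≤ 1 := card_le_one.2 fun x hx y hy => by
      obtain ⟨a, b, hab, rfl⟩ := htrans f hfC x hx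
      obtain ⟨a', b', hab', rfl⟩ := htrans f hfC y hy
      rw [hfix a b hab, hfix a' b' hab']
    obtain ⟨d, hd0, hdS⟩ := h.exists_notMem
    have := h.two_mul_card_differences hc hd0 hdS
    omega
  have hdich : (∀ x, x ∈ C ↔ x - f ∈ S) ∨ ∀ x, x ∈ C ↔ x - f ≠ 0 ∧ x - f ∉ S := by
    have himgC : ∀ W : Finset (ZMod p), #W = #C → (∀ x ∈ C, x - f ∈ W) → ∀ x, x ∈ C ↔ x - f ∈ W := by
      intro W hW hsub x
      have : C.image (· - f) = W := by
        apply eq_of_subset_of_card_le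
        · intro y hy
          obtain ⟨x, hx, rfl⟩ := mem_image.1 hy
          exact hsub x hx
        · rw [card_image_of_injective _ sub_left_injective, hW]
      rw [← this]
      simp
    by_cases h0 : c₀ - f ∈ S
    · exact Or.inl (himgC S hC.symm fun x hx => (hcoset x hx).2 h0)
    · right
      simp_rw [← mem_nonzeroCompl]
      refine himgC _ (by rw [← hc, hC]) fun x hx => mem_nonzeroCompl.2 ⟨?_, ?_⟩
      · exact sub_ne_zero.2 fun hxf => hfC (hxf ▸ hx)
      · rwa [hcoset x hx]
  refine ⟨f, hdich, fun x y hx hxf hy hyf => ?_⟩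
  rw [← sub_ne_zero] at hxf hyf
  obtain ⟨a, ha, haS⟩ : ∃ a, a * (x - f) = y - f ∧ ∀ s, a * s ∈ S ↔ s ∈ S := by
    rcases hdich with hd | hd
    · rw [hd] at hx hy
      exact h.trans _ _ hxf hx hyf hy
    · rw [hd] at hx hy
      exact h.trans_mem hc (by tauto) (by tauto)
  have ha0 : a ≠ 0 := by
    rintro rfl
    rw [zero_mul] at ha
    exact hyf ha.symm
  have hc₀f : c₀ - f ≠ 0 := sub_ne_zero.2 fun hxf => hfC (hxf ▸ hc₀)
  have hmem : a * (c₀ - f) + f ∈ C := by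
    rcases hdich with hd | hd
    · rw [hd] at hc₀ ⊢
      rwa [add_sub_cancel_right, haS]
    · rw [hd] at hc₀ ⊢
      rw [add_sub_cancel_right, haS]
      exact ⟨mul_ne_zero ha0 hc₀.1, hc₀.2⟩
  obtain ⟨a', b, hab, hb⟩ := htrans c₀ hc₀ _ hmem
  have haa : a' = a := by
    apply mul_right_cancel₀ hc₀f
    rw [← hact a' b hab, hb, add_sub_cancel_right]
  refine ⟨a', b, hab, ?_⟩
  have := hact a' b hab x
  rw [haa, ha] at this
  rw [haa]
  exact sub_left_injective this

end IsCyclotomic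

section Graph

variable {V : Type*} {Γ : SimpleGraph V} {p : ℕ} [Fact p.Prime]

/-- The neighbourhood of `u` identified with `ZMod p`, so that adjacency inside it is given by
differences in `S` and the stabilizer of `u` acts by affine maps. -/
structure LocalCoordinates (Γ : SimpleGraph V) (p : ℕ) [Fact p.Prime] (u : V) where
  S : Finset (ZMod p)
  isCyclotomic : IsCyclotomic S
  e : ZMod p ≃ Γ.neighborSet u
  adj_iff : ∀ i j, Γ.Adj (e i) (e j) ↔ i - j ∈ S
  affine : ∀ φ : Γ ≃g Γ, φ u = u →
    ∃ a b, (∀ s, a * s ∈ S ↔ s ∈ S) ∧ ∀ i, φ (e i) = e (a * i + b)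

theorem TwoGeodesicTransitive.nonempty_localCoordinates (hΓ : TwoGeodesicTransitive Γ)
    (hreg : ∀ v : V, Nat.card (Γ.neighborSet v) = p) (u : V)
    (htri : ∃ x y, Γ.Adj u x ∧ Γ.Adj u y ∧ Γ.Adj x y)
    (hnon : ∃ x y, Γ.Adj u x ∧ Γ.Adj u y ∧ x ≠ y ∧ ¬ Γ.Adj x y) :
    Nonempty (LocalCoordinates Γ p u) := by
  classical
  have hfin : Finite (Γ.neighborSet u) :=
    Nat.finite_of_card_ne_zero (by rw [hreg]; exact (Fact.out : p.Prime).ne_zero)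
  have := Fintype.ofFinite (Γ.neighborSet u)
  have hX : Fintype.card (Γ.neighborSet u) = p := by rw [← Nat.card_eq_fintype_card, hreg]
  let G : Subgroup (Equiv.Perm (Γ.neighborSet u)) :=
    { carrier := {π | ∃ φ : Γ ≃g Γ, φ u = u ∧ ∀ x : Γ.neighborSet u, φ x = π x}
      one_mem' := ⟨RelIso.refl _, rfl, fun _ => rfl⟩
      mul_mem' := by
        rintro π ρ ⟨φ, hφ, hφπ⟩ ⟨ψ, hψ, hψρ⟩
        exact ⟨ψ.trans φ, by simp [hψ, hφ], fun x => by simp [hψρ, hφπ]⟩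
      inv_mem' := by
        rintro π ⟨φ, hφ, hφπ⟩
        exact ⟨φ.symm, by rw [RelIso.symm_apply_eq, hφ],
          fun x => by rw [RelIso.symm_apply_eq, hφπ]; simp⟩ }
  have hres : ∀ φ : Γ ≃g Γ, φ u = u → ∃ π ∈ G, ∀ x : Γ.neighborSet u, φ x = π x := by
    intro φ hφ
    refine ⟨φ.toEquiv.subtypeEquiv fun a => ?_, ⟨φ, hφ, fun _ => rfl⟩, fun _ => rfl⟩
    simp only [mem_neighborSet]
    conv_lhs => rw [← φ.map_adj_iff, hφ]
    rfl
  obtain ⟨e, S, ⟨h0, hS, hd, hneg⟩, hadj, haff⟩ := exists_affine_coordinates hX G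
    (by
      rintro ⟨x, hx⟩ ⟨y, hy⟩
      obtain ⟨φ, hφ, hφx⟩ := hΓ.1 hx hy
      obtain ⟨π, hπ, h⟩ := hres φ hφ
      exact ⟨π, hπ, Subtype.ext (by rw [← h]; exact hφx)⟩)
    (Γ.induce (Γ.neighborSet u))
    (by
      rintro π ⟨φ, hφ, h⟩ x y
      simp only [comap_adj, Function.Embedding.subtype_apply]
      rw [← h, ← h, φ.map_adj_iff])
    (let ⟨x, y, hx, hy, hxy⟩ := htri; ⟨⟨x, hx⟩, ⟨y, hy⟩, hxy⟩)
    (let ⟨x, y, hx, hy, hne, hxy⟩ := hnon;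
      ⟨⟨x, hx⟩, ⟨y, hy⟩, fun h => hne (congrArg Subtype.val h), hxy⟩)
  simp only [comap_adj, Function.Embedding.subtype_apply] at hadj
  have haff' : ∀ φ : Γ ≃g Γ, φ u = u →
      ∃ a b, (∀ s, a * s ∈ S ↔ s ∈ S) ∧ ∀ i, φ (e i) = e (a * i + b) := by
    intro φ hφ
    obtain ⟨π, hπ, h⟩ := hres φ hφ
    obtain ⟨a, b, hab⟩ := haff π hπ
    have hab' : ∀ i, φ (e i) = e (a * i + b) := fun i => by rw [h, hab]
    refine ⟨a, b, fun s => ?_, hab'⟩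
    have h1 := hadj (a * s + b) (a * 0 + b)
    rw [← hab', ← hab', φ.map_adj_iff, hadj] at h1
    simpa using h1.symm
  refine ⟨⟨S, ⟨h0, hS, hd, hneg, fun x y hx0 hxS hy0 hyS => ?_⟩, e, hadj, haff'⟩⟩
  have hgeo : ∀ z, z ≠ 0 → z ∉ S → Is2Geodesic Γ (e 0) u (e z) := fun z hz0 hzS =>
    ⟨((e 0).2 : Γ.Adj _ _).symm, (e z).2, fun h => hz0 (e.injective (Subtype.ext h)).symm,
      fun h => hzS (by rwa [hadj, zero_sub, hneg] at h)⟩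
  obtain ⟨φ, hφ0, hφu, hφx⟩ := hΓ.2 (hgeo x hx0 hxS) (hgeo y hy0 hyS)
  obtain ⟨a, b, ha, hab⟩ := haff' φ hφu
  rw [hab] at hφ0 hφx
  have h1 := e.injective (Subtype.ext hφ0)
  have h2 := e.injective (Subtype.ext hφx)
  rw [mul_zero, zero_add] at h1
  rw [h1, add_zero] at h2
  exact ⟨a, h2, ha⟩

theorem LocalCoordinates.exists_eq {u x : V} (L : LocalCoordinates Γ p u) (hx : Γ.Adj u x) :
    ∃ i, (L.e i : V) = x := ⟨L.e.symm ⟨x, hx⟩, by simp⟩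

/-- Distinct non-adjacent vertices without common neighbours. -/
def IsFar (Γ : SimpleGraph V) (v x : V) : Prop :=
  x ≠ v ∧ ¬ Γ.Adj v x ∧ ∀ u, ¬ (Γ.Adj v u ∧ Γ.Adj u x)

theorem IsFar.map {v x : V} (h : IsFar Γ v x) (φ : Γ ≃g Γ) : IsFar Γ (φ v) (φ x) := by
  refine ⟨fun h' => h.1 (φ.injective h'), fun h' => h.2.1 (φ.map_adj_iff.1 h'), fun u hu => ?_⟩
  rw [← φ.apply_symm_apply u, φ.map_adj_iff, φ.map_adj_iff] at hu
  exact h.2.2 _ hu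

variable [Fintype V] [DecidableRel Γ.Adj]

theorem LocalCoordinates.card_filter_neighborFinset {u : V} (L : LocalCoordinates Γ p u)
    (P : V → Prop) [DecidablePred P] :
    #((Γ.neighborFinset u).filter P) = #(univ.filter fun i => P (L.e i)) := by
  symm
  refine card_bij (fun i _ => (L.e i : V)) (fun i hi => ?_)
    (fun i _ j _ h => L.e.injective (Subtype.ext h)) (fun x hx => ?_)
  · rw [mem_filter, mem_neighborFinset]
    exact ⟨(L.e i).2, (mem_filter.1 hi).2⟩
  · rw [mem_filter, mem_neighborFinset] at hx
    exact ⟨L.e.symm ⟨x, hx.1⟩, by simp [hx.2], by simp⟩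

variable [DecidableEq V]

theorem LocalCoordinates.card_inter {u x : V} (L : LocalCoordinates Γ p u) (hx : Γ.Adj u x) :
    #(Γ.neighborFinset u ∩ Γ.neighborFinset x) = #L.S := by
  obtain ⟨i, rfl⟩ := L.exists_eq hx
  have h := L.card_filter_neighborFinset fun z => Γ.Adj (L.e i) z
  simp_rw [L.adj_iff] at h
  have h1 : Γ.neighborFinset u ∩ Γ.neighborFinset (L.e i) =
      (Γ.neighborFinset u).filter fun z => Γ.Adj (L.e i) z := by ext; simp
  rw [h1, h]
  exact card_bij (fun j _ => i - j) (fun j hj => (mem_filter.1 hj).2)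
    (fun _ _ _ _ h => sub_right_injective h)
    (fun s hs => ⟨i - s, by simpa using hs, sub_sub_cancel i s⟩)

/-- The vertices at distance two from `v`. -/
def secondNeighborFinset (Γ : SimpleGraph V) [DecidableRel Γ.Adj] (v : V) : Finset V :=
  univ.filter fun w => w ≠ v ∧ ¬ Γ.Adj v w ∧ ∃ u, Γ.Adj v u ∧ Γ.Adj u w

theorem mem_secondNeighborFinset {v w : V} :
    w ∈ secondNeighborFinset Γ v ↔ w ≠ v ∧ ¬ Γ.Adj v w ∧ ∃ u, Γ.Adj v u ∧ Γ.Adj u w := by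
  simp [secondNeighborFinset]

theorem Is2Geodesic.mem_secondNeighborFinset {v u w : V} (h : Is2Geodesic Γ v u w) :
    w ∈ secondNeighborFinset Γ v :=
  _root_.mem_secondNeighborFinset.2 ⟨h.2.2.1.symm, h.2.2.2, u, h.1, h.2.1⟩

theorem exists_is2Geodesic_of_mem {v w : V} (h : w ∈ secondNeighborFinset Γ v) :
    ∃ u, Is2Geodesic Γ v u w :=
  let ⟨h1, h2, u, h3, h4⟩ := mem_secondNeighborFinset.1 h
  ⟨u, h3, h4, h1.symm, h2⟩

theorem card_inter_map (φ : Γ ≃g Γ) (x y : V) :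
    #(Γ.neighborFinset (φ x) ∩ Γ.neighborFinset (φ y)) =
      #(Γ.neighborFinset x ∩ Γ.neighborFinset y) := by
  symm
  refine card_bij (fun z _ => φ z) (fun z hz => ?_) (fun _ _ _ _ h => φ.injective h)
    (fun z hz => ⟨φ.symm z, ?_, φ.apply_symm_apply z⟩)
  · simpa [φ.map_adj_iff] using hz
  · simp only [mem_inter, mem_neighborFinset] at hz ⊢
    rw [← φ.map_adj_iff, ← φ.map_adj_iff (v := y)]
    simpa using hz

/-- The parameters of a 2-geodesic transitive graph of prime valency `p` with triangles in which
some two vertices at distance two have different neighbourhoods. -/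
theorem TwoGeodesicTransitive.parameters (hΓ : TwoGeodesicTransitive Γ)
    (hdeg : ∀ v : V, #(Γ.neighborFinset v) = p) (L : ∀ u, LocalCoordinates Γ p u)
    {v u w : V} (hgeo : Is2Geodesic Γ v u w)
    (hne : #(Γ.neighborFinset v ∩ Γ.neighborFinset w) < p) :
    ∃ m, 2 * m + 1 = p ∧ (∀ x, #(L x).S = m ∧ #(nonzeroCompl (L x).S) = m) ∧
      (∀ x y z, Is2Geodesic Γ x y z → #(Γ.neighborFinset x ∩ Γ.neighborFinset z) = m) ∧
      #(secondNeighborFinset Γ v) = p := by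
  have hp : p.Prime := Fact.out
  set c := #(Γ.neighborFinset v ∩ Γ.neighborFinset w) with hcdef
  have hc : ∀ x y z, Is2Geodesic Γ x y z → #(Γ.neighborFinset x ∩ Γ.neighborFinset z) = c := by
    intro x y z hxyz
    obtain ⟨φ, rfl, rfl, rfl⟩ := hΓ.2 hgeo hxyz
    exact card_inter_map φ v w
  have hk : ∀ x, #(L x).S = #(L u).S := by
    intro x
    obtain ⟨y, hy⟩ := card_pos.1 (show 0 < #(Γ.neighborFinset x) by rw [hdeg]; exact hp.pos)
    rw [mem_neighborFinset] at hy
    obtain ⟨φ, rfl, rfl⟩ := hΓ.1 hgeo.2.1 hy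
    rw [← (L (φ u)).card_inter hy, card_inter_map, (L u).card_inter hgeo.2.1]
  set k := #(L u).S with hkdef
  set m := #(nonzeroCompl (L u).S) with hm
  have hcyc := (L u).isCyclotomic
  have hkm : k + m = p - 1 := hcyc.card_add_card
  have hk0 : 0 < k := hcyc.nonempty.card_pos
  have hm0 : 0 < m := card_pos.2
    (let ⟨d, hd⟩ := hcyc.exists_notMem; ⟨d, mem_nonzeroCompl.2 hd⟩)
  have hmx : ∀ x, #(nonzeroCompl (L x).S) = m := fun x => by
    have := (L x).isCyclotomic.card_add_card
    rw [hk] at this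
    omega
  have hcount : p * m = #(secondNeighborFinset Γ v) * c := by
    rw [← hdeg v]
    refine card_mul_eq_card_mul Γ.Adj (fun x hx => ?_) fun z hz => ?_
    · rw [mem_neighborFinset] at hx
      have h1 : (secondNeighborFinset Γ v).bipartiteAbove Γ.Adj x =
          (Γ.neighborFinset x \ Γ.neighborFinset v).erase v := by
        ext z
        simp only [mem_bipartiteAbove, mem_secondNeighborFinset, mem_erase, mem_sdiff,
          mem_neighborFinset]
        grind
      have h2 : v ∈ Γ.neighborFinset x \ Γ.neighborFinset v := by simp [hx.symm]
      have h3 := card_sdiff_add_card_inter (Γ.neighborFinset x) (Γ.neighborFinset v)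
      rw [hdeg, (L x).card_inter hx.symm, hk] at h3
      rw [h1, card_erase_of_mem h2]
      omega
    · obtain ⟨y, hy⟩ := exists_is2Geodesic_of_mem hz
      rw [← hc v y z hy]
      congr 1
      ext x
      simp [Γ.adj_comm]
  have hcm : c ∣ m := by
    have h1 : c ∣ p * m := hcount ▸ dvd_mul_left _ _
    refine Nat.Coprime.dvd_of_dvd_mul_left (Nat.Coprime.symm ((hp.coprime_iff_not_dvd).2 ?_)) h1
    intro h2
    have hc0 : 0 < c := card_pos.2 ⟨u, by simp [hgeo.1, hgeo.2.1.symm]⟩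
    have := Nat.le_of_dvd hc0 h2
    omega
  have hcle : c ≤ m := Nat.le_of_dvd hm0 hcm
  have hmu : #((Γ.neighborFinset u ∩ Γ.neighborFinset v) ∩
      (Γ.neighborFinset u ∩ Γ.neighborFinset w)) + 1 ≤ c := by
    rw [← card_insert_of_notMem (a := u) (by simp)]
    refine card_le_card fun x hx => ?_
    have h1 := hgeo.1
    have h2 := hgeo.2.1.symm
    simp only [mem_insert, mem_inter, mem_neighborFinset] at hx ⊢
    grind
  have hineq : p + 1 ≤ 3 * m := by
    have h1 := card_union_add_card_inter (Γ.neighborFinset u ∩ Γ.neighborFinset v)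
      (Γ.neighborFinset u ∩ Γ.neighborFinset w)
    rw [(L u).card_inter hgeo.1.symm, (L u).card_inter hgeo.2.1] at h1
    have h2 : #((Γ.neighborFinset u ∩ Γ.neighborFinset v) ∪
        (Γ.neighborFinset u ∩ Γ.neighborFinset w)) ≤ p - 1 - 1 := by
      rw [← hdeg u, ← card_erase_of_mem (show v ∈ _ by simpa using hgeo.1.symm),
        ← card_erase_of_mem (a := w) (by simp [hgeo.2.1, hgeo.2.2.1.symm])]
      refine card_le_card fun x hx => ?_
      have h3 := hgeo.2.2.2
      simp only [mem_union, mem_erase, mem_inter, mem_neighborFinset] at hx ⊢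
      refine ⟨?_, ?_, ?_⟩
      · rintro rfl; simp [h3] at hx
      · rintro rfl; simp [Γ.adj_comm w, h3] at hx
      · tauto
    omega
  have h2m : p - 1 = 2 * m := by
    obtain ⟨q, hq⟩ := hcyc.card_nonzeroCompl_dvd
    rw [← hm] at hq
    have hq1 : q ≠ 0 := by rintro rfl; omega
    have hq2 : q ≠ 1 := by rintro rfl; omega
    have hq3 : q < 3 := by
      by_contra h
      have := Nat.mul_le_mul_left m (not_lt.1 h)
      omega
    have : q = 2 := by omega
    rw [hq, this, mul_comm]
  have hkm' : k = m := by omega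
  have hceq : c = m := by
    obtain ⟨i, hi⟩ := (L u).exists_eq hgeo.1.symm
    obtain ⟨j, hj⟩ := (L u).exists_eq hgeo.2.1
    have hij0 : j - i ≠ 0 := sub_ne_zero.2 fun h => hgeo.2.2.1 (by rw [← hi, ← hj, h])
    have hijS : j - i ∉ (L u).S := fun h => hgeo.2.2.2 (by
      rw [← hi, ← hj, Γ.adj_comm, (L u).adj_iff]; exact h)
    have h1 := hcyc.two_mul_card_differences hkm' hij0 hijS
    have h2 := (L u).card_filter_neighborFinset fun z => Γ.Adj z v ∧ Γ.Adj z w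
    rw [← hi, ← hj] at h2
    simp_rw [(L u).adj_iff] at h2
    have h3 : #(univ.filter fun x => x - i ∈ (L u).S ∧ x - j ∈ (L u).S) =
        #((L u).S.filter fun x => x - (j - i) ∈ (L u).S) := by
      refine card_bij (fun x _ => x - i) (fun x hx => ?_) (fun _ _ _ _ h => sub_left_injective h)
        (fun x hx => ⟨x + i, ?_, add_sub_cancel_right x i⟩)
      · simp only [mem_filter, mem_univ, true_and, sub_sub_sub_cancel_right] at hx ⊢
        exact hx
      · simp only [mem_filter, mem_univ, true_and, add_sub_cancel_right] at hx ⊢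
        rwa [sub_sub_eq_add_sub] at hx
    have h4 : (Γ.neighborFinset u).filter (fun z => Γ.Adj z (L u |>.e i) ∧ Γ.Adj z (L u |>.e j)) =
        (Γ.neighborFinset u ∩ Γ.neighborFinset v) ∩
          (Γ.neighborFinset u ∩ Γ.neighborFinset w) := by
      ext z
      simp only [hi, hj, mem_filter, mem_inter, mem_neighborFinset, Γ.adj_comm z]
      tauto
    rw [h4, h3] at h2
    obtain ⟨q, hq⟩ := hcm
    have hq1 : q ≠ 0 := by rintro rfl; omega
    have hq2 : q < 2 := by
      by_contra h
      have := Nat.mul_le_mul_left c (not_lt.1 h)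
      omega
    have : q = 1 := by omega
    rw [hq, this, mul_one]
  refine ⟨m, by have := hp.pos; omega, fun x => ⟨(hk x).trans hkm', hmx x⟩,
    fun x y z h => (hc x y z h).trans hceq, ?_⟩
  rw [hceq] at hcount
  exact (Nat.eq_of_mul_eq_mul_right hm0 hcount).symm

/-- A vertex at distance two from `v` has at most one neighbour at distance three from `v`. -/
theorem TwoGeodesicTransitive.eq_of_isFar (hΓ : TwoGeodesicTransitive Γ) {v w : V}
    (L : LocalCoordinates Γ p w) (hS : #L.S = #(nonzeroCompl L.S))
    (hw : w ∈ secondNeighborFinset Γ v)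
    (hc : #(Γ.neighborFinset v ∩ Γ.neighborFinset w) = #L.S) {q z : V}
    (hq : IsFar Γ v q) (hwq : Γ.Adj w q) (hz : IsFar Γ v z) (hwz : Γ.Adj w z) : z = q := by
  obtain ⟨hwv, hvw, -⟩ := mem_secondNeighborFinset.1 hw
  set C : Finset (ZMod p) := univ.filter fun i => Γ.Adj v (L.e i) with hC
  have hCmem : ∀ i, i ∈ C ↔ Γ.Adj v (L.e i) := fun i => by simp [hC]
  have hCcard : #C = #L.S := by
    rw [hC, ← L.card_filter_neighborFinset fun x => Γ.Adj v x, ← hc]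
    congr 1
    ext x
    simp [and_comm]
  obtain ⟨f, hf, htrans⟩ := L.isCyclotomic.exists_center hS C hCcard
    (fun a b => (∀ s, a * s ∈ L.S ↔ s ∈ L.S) ∧
      ∃ φ : Γ ≃g Γ, φ v = v ∧ ∀ i, φ (L.e i) = L.e (a * i + b))
    (fun a b h => h.1)
    (by
      rintro a b ⟨-, φ, hφ, hab⟩ x hx
      rw [hCmem] at hx ⊢
      have := φ.map_adj_iff.2 hx
      rwa [hφ, hab] at this)
    (by
      intro x hx y hy
      rw [hCmem] at hx hy
      obtain ⟨φ, hφv, hφx, hφw⟩ := hΓ.2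
        (⟨hx, ((L.e x).2 : Γ.Adj _ _).symm, hwv.symm, hvw⟩ : Is2Geodesic Γ v (L.e x) w)
        (⟨hy, ((L.e y).2 : Γ.Adj _ _).symm, hwv.symm, hvw⟩ : Is2Geodesic Γ v (L.e y) w)
      obtain ⟨a, b, haS, hab⟩ := L.affine φ hφw
      refine ⟨a, b, ⟨haS, φ, hφv, hab⟩, L.e.injective (Subtype.ext ?_)⟩
      rw [← hab, hφx])
  have hfar : ∀ x y, x ∉ C → x ≠ f → y ∉ C → y ≠ f → IsFar Γ v (L.e x) →
      IsFar Γ v (L.e y) := by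
    intro x y hx hxf hy hyf h
    obtain ⟨a, b, ⟨-, φ, hφ, hab⟩, rfl⟩ := htrans x y hx hxf hy hyf
    rw [← hab, ← hφ]
    exact h.map φ
  have hnf : ∃ y, y ∉ C ∧ y ≠ f ∧ ¬ IsFar Γ v (L.e y) := by
    obtain ⟨s, d, hs, hd0, hdS, hsd⟩ := L.isCyclotomic.exists_sub_mem hS
    have hadj : Γ.Adj (L.e (s + f)) (L.e (d + f)) := by
      rw [L.adj_iff, add_sub_add_right_eq_sub]; exact hsd
    have hs0 : s ≠ 0 := fun h => L.isCyclotomic.zero_notMem (h ▸ hs)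
    rcases hf with hf | hf
    · exact ⟨d + f, by simp [hf, hdS], by simp [hd0], fun h =>
        h.2.2 _ ⟨(hCmem (s + f)).1 (by simp [hf, hs]), hadj⟩⟩
    · exact ⟨s + f, by simp [hf, hs], by simp [hs0], fun h =>
        h.2.2 _ ⟨(hCmem (d + f)).1 (by simp [hf, hd0, hdS]), hadj.symm⟩⟩
  obtain ⟨y, hyC, hyf, hy⟩ := hnf
  have key : ∀ x, Γ.Adj w x → IsFar Γ v x → x = L.e f := by
    intro x hx hxfar
    obtain ⟨i, rfl⟩ := L.exists_eq hx
    by_contra hne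
    exact hy (hfar i y (fun h => hxfar.2.1 ((hCmem i).1 h)) (fun h => hne (by rw [h])) hyC hyf hxfar)
  rw [key z hwz hz, key q hwq hq]

theorem eq_or_adj_or_mem_or_isFar (v x : V) :
    x = v ∨ Γ.Adj v x ∨ x ∈ secondNeighborFinset Γ v ∨ IsFar Γ v x := by
  rw [mem_secondNeighborFinset, IsFar]
  grind

/-- If `v'` is at distance three from `v`, its neighbours are the vertices at distance two
from `v`. -/
theorem TwoGeodesicTransitive.secondNeighborFinset_eq (hΓ : TwoGeodesicTransitive Γ)
    (hdeg : ∀ v : V, #(Γ.neighborFinset v) = p) (L : ∀ u, LocalCoordinates Γ p u)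
    {v u w v' : V} (hgeo : Is2Geodesic Γ v u w) (hfar : IsFar Γ v v') (hwv' : Γ.Adj w v') :
    secondNeighborFinset Γ v = Γ.neighborFinset v' ∧
      ∀ x ∈ secondNeighborFinset Γ v, ∀ q z, IsFar Γ v q → Γ.Adj x q → IsFar Γ v z → Γ.Adj x z →
        z = q := by
  have hlt : #(Γ.neighborFinset v ∩ Γ.neighborFinset w) < p := by
    rw [← hdeg w]
    refine card_lt_card ((ssubset_iff_of_subset inter_subset_right).2 ⟨v', ?_, ?_⟩)
    · simpa using hwv'
    · simp [hfar.2.1]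
  obtain ⟨m, hpm, hS, hc, hD⟩ := hΓ.parameters hdeg L hgeo hlt
  set D := secondNeighborFinset Γ v with hDdef
  have huniq : ∀ x ∈ D, ∀ q z, IsFar Γ v q → Γ.Adj x q → IsFar Γ v z → Γ.Adj x z → z = q := by
    intro x hx q z hq hxq hz hxz
    obtain ⟨y, hy⟩ := exists_is2Geodesic_of_mem hx
    exact hΓ.eq_of_isFar (L x) (by rw [(hS x).1, (hS x).2]) hx
      (by rw [hc v y x hy, (hS x).1]) hq hxq hz hxz
  have hbig : ∀ x ∈ D, ∀ q, IsFar Γ v q → Γ.Adj x q → m + 1 ≤ #(Γ.neighborFinset q ∩ D) := by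
    intro x hx q hq hxq
    rw [← (hS x).1, ← (L x).card_inter hxq, ← card_insert_of_notMem (a := x) (by simp)]
    refine card_le_card fun z hz => ?_
    rw [mem_insert, mem_inter, mem_neighborFinset, mem_neighborFinset] at hz
    rw [mem_inter, mem_neighborFinset]
    rcases hz with rfl | ⟨hxz, hqz⟩
    · exact ⟨hxq.symm, hx⟩
    refine ⟨hqz, ?_⟩
    rcases eq_or_adj_or_mem_or_isFar (Γ := Γ) v z with rfl | hvz | hzD | hz
    · exact absurd hqz.symm hq.2.1
    · exact absurd ⟨hvz, hqz.symm⟩ (hq.2.2 z)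
    · exact hzD
    · exact absurd (huniq x hx q z hq hxq hz hxz) hqz.ne'
  have hsub : D ⊆ Γ.neighborFinset v' := by
    intro x hx
    rw [mem_neighborFinset]
    by_contra hxv'
    obtain ⟨y, hy⟩ := exists_is2Geodesic_of_mem hx
    obtain ⟨φ, hφv, -, hφw⟩ := hΓ.2 hgeo hy
    have hq : IsFar Γ v (φ v') := by
      have := hfar.map φ
      rwa [hφv] at this
    have hxq : Γ.Adj x (φ v') := by rw [← hφw, φ.map_adj_iff]; exact hwv'
    have h1 := hbig x hx _ hq hxq
    have h2 := hbig w hgeo.mem_secondNeighborFinset v' hfar hwv'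
    have hdisj : Disjoint (Γ.neighborFinset (φ v') ∩ D) (Γ.neighborFinset v' ∩ D) := by
      rw [Finset.disjoint_left]
      intro z hz1 hz2
      rw [mem_inter, mem_neighborFinset] at hz1 hz2
      have := huniq z hz1.2 v' (φ v') hfar hz2.1.symm hq hz1.1.symm
      exact hxv' (this ▸ hxq.symm)
    have h3 : #((Γ.neighborFinset (φ v') ∩ D) ∪ (Γ.neighborFinset v' ∩ D)) ≤ #D :=
      card_le_card (union_subset inter_subset_right inter_subset_right)
    rw [card_union_of_disjoint hdisj, hD] at h3
    omega
  exact ⟨eq_of_subset_of_card_le hsub (by rw [hD, hdeg]), huniq⟩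

end Graph

end

theorem stmt12 {V : Type*} [Fintype V] (Γ : SimpleGraph V) (p : ℕ)
    (hp : p.Prime)
    (hreg : ∀ v : V, Nat.card (Γ.neighborSet v) = p)
    (hconn : Γ.Connected)
    (hnc : Γ ≠ ⊤)
    (h2gt : TwoGeodesicTransitive Γ)
    (h2at : ¬ TwoArcTransitive Γ) :
    ∀ v v' : V, Γ.dist v v' = 3 →
      ({x : V | Γ.dist v x = 2} = Γ.neighborSet v' ∧
       (∀ x : V, x = v ∨ Γ.Adj v x ∨ Γ.Adj v' x ∨ x = v') ∧
       v ≠ v' ∧ ¬ Γ.Adj v v' ∧ (∀ x : V, ¬ (Γ.Adj v x ∧ Γ.Adj v' x))) := by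
  classical
  intro v v' hdist
  have : Fact p.Prime := ⟨hp⟩
  have hdeg : ∀ x : V, (Γ.neighborFinset x).card = p := fun x => by
    rw [card_neighborFinset_eq_degree, ← card_neighborSet_eq_degree, ← Nat.card_eq_fintype_card,
      hreg]
  have hfar : IsFar Γ v v' := by
    refine ⟨?_, ?_, ?_⟩
    · rintro rfl
      rw [SimpleGraph.dist_self] at hdist
      omega
    · intro h
      rw [dist_eq_one_iff_adj.2 h] at hdist
      omega
    · rintro u ⟨h1, h2⟩
      have := dist_le (Walk.cons h1 (Walk.cons h2 Walk.nil))
      rw [hdist] at this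
      simp at this
  obtain ⟨u, w, hgeo, hwv'⟩ : ∃ u w, Is2Geodesic Γ v u w ∧ Γ.Adj w v' := by
    obtain ⟨W, hW⟩ := hconn.exists_walk_length_eq_dist v v'
    rw [hdist] at hW
    match W, hW with
    | .cons (v := u) h1 (.cons (v := w) h2 (.cons h3 .nil)), _ =>
      exact ⟨u, w, ⟨h1, h2, fun h => hfar.2.1 (h ▸ h3), fun h => hfar.2.2 w ⟨h, h3⟩⟩, h3⟩
  have htri : ∃ x y z, Γ.Adj x y ∧ Γ.Adj y z ∧ x ≠ z ∧ Γ.Adj x z := by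
    by_contra! h
    exact h2at ⟨h2gt.1, fun a b c a' b' c' h1 h2 =>
      h2gt.2 ⟨h1.1, h1.2.1, h1.2.2, h a b c h1.1 h1.2.1 h1.2.2⟩
        ⟨h2.1, h2.2.1, h2.2.2, h a' b' c' h2.1 h2.2.1 h2.2.2⟩⟩
  have hL : ∀ x, Nonempty (LocalCoordinates Γ p x) := by
    intro x
    obtain ⟨y, hy⟩ := Finset.card_pos.1 (show 0 < (Γ.neighborFinset x).card by rw [hdeg]; exact hp.pos)
    rw [mem_neighborFinset] at hy
    refine h2gt.nonempty_localCoordinates hreg x ?_ ?_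
    · obtain ⟨a, b, c, hab, hbc, -, hac⟩ := htri
      obtain ⟨φ, rfl, rfl⟩ := h2gt.1 hab hy
      exact ⟨φ b, φ c, hy, φ.map_adj_iff.2 hac, φ.map_adj_iff.2 hbc⟩
    · obtain ⟨φ, rfl, rfl⟩ := h2gt.1 hgeo.2.1 hy
      exact ⟨φ v, φ w, φ.map_adj_iff.2 hgeo.1.symm, hy, fun h => hgeo.2.2.1 (φ.injective h),
        fun h => hgeo.2.2.2 (φ.map_adj_iff.1 h)⟩
  have L : ∀ x, LocalCoordinates Γ p x := fun x => (hL x).some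
  obtain ⟨hDN, huniq⟩ := h2gt.secondNeighborFinset_eq hdeg L hgeo hfar hwv'
  have hDadj : ∀ x, x ∈ secondNeighborFinset Γ v ↔ Γ.Adj v' x := fun x => by rw [hDN, mem_neighborFinset]
  refine ⟨?_, ?_, hfar.1.symm, hfar.2.1, fun x hx => hfar.2.2 x ⟨hx.1, hx.2.symm⟩⟩
  · ext x
    rw [Set.mem_ofPred_eq, mem_neighborSet, ← hDadj, mem_secondNeighborFinset,
      SimpleGraph.dist, ENat.toNat_eq_iff two_ne_zero, Nat.cast_ofNat, edist_eq_two_iff]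
    simp only [Set.Nonempty, mem_commonNeighbors, Γ.adj_comm x, ne_comm (a := v)]
  · have hstep : ∀ x z, Γ.Adj x z → (x = v ∨ Γ.Adj v x ∨ Γ.Adj v' x ∨ x = v') →
        z = v ∨ Γ.Adj v z ∨ Γ.Adj v' z ∨ z = v' := by
      rintro x z hxz (rfl | hx | hx | rfl)
      · exact Or.inr (Or.inl hxz)
      · rcases eq_or_adj_or_mem_or_isFar (Γ := Γ) v z with h | h | h | h
        · exact Or.inl h
        · exact Or.inr (Or.inl h)
        · exact Or.inr (Or.inr (Or.inl ((hDadj z).1 h)))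
        · exact absurd ⟨hx, hxz⟩ (h.2.2 x)
      · rcases eq_or_adj_or_mem_or_isFar (Γ := Γ) v z with h | h | h | h
        · exact Or.inl h
        · exact Or.inr (Or.inl h)
        · exact Or.inr (Or.inr (Or.inl ((hDadj z).1 h)))
        · exact Or.inr (Or.inr (Or.inr (huniq x ((hDadj x).2 hx) v' z hfar hx.symm h hxz)))
      · exact Or.inr (Or.inr (Or.inl hxz))
    have hwalk : ∀ x z, Γ.Walk x z → (x = v ∨ Γ.Adj v x ∨ Γ.Adj v' x ∨ x = v') →
        z = v ∨ Γ.Adj v z ∨ Γ.Adj v' z ∨ z = v' := by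
      intro x z W
      induction W with
      | nil => exact id
      | cons h _ ih => exact fun hx => ih (hstep _ _ h hx)
    exact fun x => (hconn.preconnected v x).elim fun W => hwalk v x W (Or.inl rfl)
end
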